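/- Let n, k, d be integers with 2 ≤ d < k, n ≥ k+1 and 2n > (d+2)(k-d+2). If 𝓕 is a nonempty nontrivial d-wise intersecting family of k-element subsets of [n], then |𝓕| ≤ max{|H(n,k,d)|, |A(n,k,d)|}; moreover, equality holds only if 𝓕 is the image of A(n,k,d) or of H(n,k,d) under a permutation of [n]. -/

import Mathlib

/-- `famA n k d` is the family `A(n,k,d) = {A ⊆ [n] : |A| = k, |A ∩ [d+1]| ≥ d}`. -/
def famA (n k d : ℕ) : Finset (Finset ℕ) :=
  ((Finset.Icc 1 n).powersetCard k).filter (fun A => d ≤ (A ∩ Finset.Icc 1 (d + 1)).card)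

/-- `famH n k d` is the family
`H(n,k,d) = {A ⊆ [n] : |A| = k, [d-1] ⊆ A, A ∩ [d,k+1] ≠ ∅} ∪ {[k+1] \ {i} : i ∈ [d-1]}`. -/
def famH (n k d : ℕ) : Finset (Finset ℕ) :=
  ((Finset.Icc 1 n).powersetCard k).filter
    (fun A => Finset.Icc 1 (d - 1) ⊆ A ∧ (A ∩ Finset.Icc d (k + 1)).Nonempty)
    ∪ (Finset.Icc 1 (d - 1)).image (fun i => Finset.Icc 1 (k + 1) \ {i})

section

open Finset

/-- `𝓕` is a family of `k`-subsets of `[n]`, any two members share at least `t` elements, and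
fewer than `t` elements are common to all members. -/
structure NontrivialIntersecting (n k t : ℕ) (𝓕 : Finset (Finset ℕ)) : Prop where
  subset : ∀ A ∈ 𝓕, A ⊆ Icc 1 n
  card_eq : ∀ A ∈ 𝓕, #A = k
  le_card_inter : ∀ A ∈ 𝓕, ∀ B ∈ 𝓕, t ≤ #(A ∩ B)
  card_lt : ∀ T : Finset ℕ, (∀ A ∈ 𝓕, T ⊆ A) → #T < t

/-- A nontrivial `t`-intersecting family of the largest possible size. -/
def IsLargest (n k t : ℕ) (𝓕 : Finset (Finset ℕ)) : Prop :=
  NontrivialIntersecting n k t 𝓕 ∧ ∀ 𝓖, NontrivialIntersecting n k t 𝓖 → #𝓖 ≤ #𝓕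

/-- The set `A` with the elements `i` and `j` exchanged. -/
def exchange (i j : ℕ) (A : Finset ℕ) : Finset ℕ := A.image (Equiv.swap i j)

/-- The compression of `𝓕` replacing `j` by `i`. -/
def shift (i j : ℕ) (𝓕 : Finset (Finset ℕ)) : Finset (Finset ℕ) :=
  {A ∈ 𝓕 | (j ∈ A ∧ i ∉ A) → exchange i j A ∈ 𝓕} ∪
    {A ∈ 𝓕 | j ∈ A ∧ i ∉ A}.image (exchange i j)

theorem mem_image_perm {σ : Equiv.Perm ℕ} {A : Finset ℕ} {x : ℕ} :
    x ∈ A.image σ ↔ σ.symm x ∈ A := by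
  constructor
  · intro h
    obtain ⟨y, hy, rfl⟩ := mem_image.1 h
    simpa using hy
  · intro h
    exact mem_image.2 ⟨_, h, by simp⟩

theorem mem_exchange {i j x : ℕ} {A : Finset ℕ} :
    x ∈ exchange i j A ↔ (if x = i then j else if x = j then i else x) ∈ A := by
  rw [exchange, mem_image_perm, Equiv.symm_swap, Equiv.swap_apply_def]

theorem exchange_exchange (i j : ℕ) (A : Finset ℕ) : exchange i j (exchange i j A) = A := by
  ext x
  grind [mem_exchange]

theorem exchange_injective (i j : ℕ) : Function.Injective (exchange i j) :=
  Function.LeftInverse.injective (exchange_exchange i j)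

theorem card_exchange (i j : ℕ) (A : Finset ℕ) : #(exchange i j A) = #A :=
  card_image_of_injective _ (Equiv.injective _)

theorem exchange_inter (i j : ℕ) (A B : Finset ℕ) :
    exchange i j (A ∩ B) = exchange i j A ∩ exchange i j B :=
  image_inter _ _ (Equiv.injective _)

theorem card_exchange_inter (i j : ℕ) (A B : Finset ℕ) :
    #(exchange i j A ∩ B) = #(A ∩ exchange i j B) := by
  rw [← card_exchange i j, exchange_inter, exchange_exchange]

theorem exchange_eq_self {i j : ℕ} {A : Finset ℕ} (h : i ∈ A ↔ j ∈ A) : exchange i j A = A := by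
  ext x
  grind [mem_exchange]

theorem exchange_subset {i j n : ℕ} {A : Finset ℕ} (hi : i ∈ Icc 1 n) (hj : j ∈ Icc 1 n)
    (hA : A ⊆ Icc 1 n) : exchange i j A ⊆ Icc 1 n := by
  intro x hx
  grind [mem_exchange]

theorem mem_shift {i j : ℕ} {𝓕 : Finset (Finset ℕ)} {A : Finset ℕ} :
    A ∈ shift i j 𝓕 ↔ (A ∈ 𝓕 ∧ ((j ∈ A ∧ i ∉ A) → exchange i j A ∈ 𝓕)) ∨
      (exchange i j A ∈ 𝓕 ∧ i ∈ A ∧ j ∉ A) := by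
  simp only [shift, mem_union, mem_filter, mem_image]
  refine or_congr Iff.rfl ⟨?_, ?_⟩
  · rintro ⟨B, ⟨hB, h1, h2⟩, rfl⟩
    rw [exchange_exchange]
    grind [mem_exchange]
  · rintro ⟨h, h1, h2⟩
    exact ⟨_, ⟨h, by grind [mem_exchange]⟩, exchange_exchange i j A⟩

theorem shift_sdiff (i j : ℕ) (𝓕 : Finset (Finset ℕ)) :
    shift i j 𝓕 \ 𝓕 = (𝓕 \ shift i j 𝓕).image (exchange i j) := by
  ext A
  simp only [mem_sdiff, mem_image]
  constructor
  · rintro ⟨h1, h2⟩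
    refine ⟨exchange i j A, ?_, exchange_exchange i j A⟩
    rw [mem_shift] at h1
    rw [mem_shift, exchange_exchange]
    grind [mem_exchange]
  · rintro ⟨B, ⟨h1, h2⟩, rfl⟩
    rw [mem_shift] at h2
    rw [mem_shift, exchange_exchange]
    grind [mem_exchange]

theorem card_shift (i j : ℕ) (𝓕 : Finset (Finset ℕ)) : #(shift i j 𝓕) = #𝓕 := by
  have h1 : #(shift i j 𝓕 \ 𝓕) = #(𝓕 \ shift i j 𝓕) := by
    rw [shift_sdiff, card_image_of_injective _ (exchange_injective i j)]
  have h2 := card_sdiff_add_card_inter (shift i j 𝓕) 𝓕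
  have h3 := card_sdiff_add_card_inter 𝓕 (shift i j 𝓕)
  rw [inter_comm] at h3
  omega

/-- The total weight of a family, a potential that decreases under compressions. -/
def weight (𝓕 : Finset (Finset ℕ)) : ℕ := ∑ A ∈ 𝓕, ∑ x ∈ A, x

theorem exchange_eq_insert_erase {i j : ℕ} {A : Finset ℕ} (hj : j ∈ A) (hi : i ∉ A) :
    exchange i j A = insert i (A.erase j) := by
  ext x
  grind [mem_exchange]

theorem sum_exchange_lt {i j : ℕ} {A : Finset ℕ} (hij : i < j) (hj : j ∈ A) (hi : i ∉ A) :
    ∑ x ∈ exchange i j A, x < ∑ x ∈ A, x := by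
  rw [exchange_eq_insert_erase hj hi, sum_insert (by simp [hi]), ← add_sum_erase A _ hj]
  omega

theorem weight_shift_lt {i j : ℕ} {𝓕 : Finset (Finset ℕ)} (hij : i < j)
    (h : shift i j 𝓕 ≠ 𝓕) : weight (shift i j 𝓕) < weight 𝓕 := by
  have h1 : (𝓕 \ shift i j 𝓕).Nonempty := by
    rw [sdiff_nonempty]
    intro hs
    exact h (eq_of_subset_of_card_le hs (card_shift i j 𝓕).le).symm
  have h2 := sum_inter_add_sum_sdiff 𝓕 (shift i j 𝓕) (fun A => ∑ x ∈ A, x)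
  have h3 := sum_inter_add_sum_sdiff (shift i j 𝓕) 𝓕 (fun A => ∑ x ∈ A, x)
  rw [inter_comm, shift_sdiff, sum_image (fun _ _ _ _ h => exchange_injective i j h)] at h3
  have h4 : ∑ A ∈ 𝓕 \ shift i j 𝓕, ∑ x ∈ exchange i j A, x <
      ∑ A ∈ 𝓕 \ shift i j 𝓕, ∑ x ∈ A, x := by
    refine sum_lt_sum_of_nonempty h1 fun A hA => ?_
    simp only [mem_sdiff, mem_shift] at hA
    exact sum_exchange_lt hij (by tauto) (by tauto)
  unfold weight
  omega

theorem exchange_mem_of_shift_eq {i j : ℕ} {𝓕 : Finset (Finset ℕ)} {A : Finset ℕ}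
    (h : shift i j 𝓕 = 𝓕) (hA : A ∈ 𝓕) (hj : j ∈ A) (hi : i ∉ A) : exchange i j A ∈ 𝓕 := by
  rw [← h, mem_shift] at hA
  tauto

theorem subset_of_mem_shift {n i j : ℕ} {𝓕 : Finset (Finset ℕ)}
    (hi : i ∈ Icc 1 n) (hj : j ∈ Icc 1 n) (h : ∀ A ∈ 𝓕, A ⊆ Icc 1 n) :
    ∀ A ∈ shift i j 𝓕, A ⊆ Icc 1 n := by
  intro A hA
  rcases mem_shift.1 hA with h1 | h1
  · exact h A h1.1
  · rw [← exchange_exchange i j A]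
    exact exchange_subset hi hj (h _ h1.1)

theorem card_of_mem_shift {k i j : ℕ} {𝓕 : Finset (Finset ℕ)}
    (h : ∀ A ∈ 𝓕, #A = k) : ∀ A ∈ shift i j 𝓕, #A = k := by
  intro A hA
  rcases mem_shift.1 hA with h1 | h1
  · exact h A h1.1
  · rw [← card_exchange i j A]
    exact h _ h1.1

theorem le_card_inter_of_mem_shift {t i j : ℕ} {𝓕 : Finset (Finset ℕ)}
    (h : ∀ A ∈ 𝓕, ∀ B ∈ 𝓕, t ≤ #(A ∩ B)) :
    ∀ A ∈ shift i j 𝓕, ∀ B ∈ shift i j 𝓕, t ≤ #(A ∩ B) := by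
  have key : ∀ A B, exchange i j A ∈ 𝓕 → i ∈ A → j ∉ A → B ∈ 𝓕 →
      ((j ∈ B ∧ i ∉ B) → exchange i j B ∈ 𝓕) → t ≤ #(A ∩ B) := by
    intro A B hA hi hj hB hB'
    by_cases hsw : exchange i j B ∈ 𝓕
    · have := h _ hA _ hsw
      rwa [← exchange_inter, card_exchange] at this
    · have hiB : i ∈ B ∧ j ∉ B := by
        by_contra hc
        have : j ∈ B → i ∈ B := fun h1 => by
          by_contra h2
          exact hsw (hB' ⟨h1, h2⟩)
        exact hsw (by rwa [exchange_eq_self (by tauto)])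
      refine (h _ hA _ hB).trans (card_le_card fun x hx => ?_)
      grind [mem_exchange]
  intro A hA B hB
  rcases mem_shift.1 hA with h1 | h1 <;> rcases mem_shift.1 hB with h2 | h2
  · exact h _ h1.1 _ h2.1
  · rw [inter_comm]
    exact key B A h2.1 h2.2.1 h2.2.2 h1.1 h1.2
  · exact key A B h1.1 h1.2.1 h1.2.2 h2.1 h2.2
  · have := h _ h1.1 _ h2.1
    rwa [← exchange_inter, card_exchange] at this

theorem IsLargest.isLargest_shift {n k t i j : ℕ} {𝓕 : Finset (Finset ℕ)} (h : IsLargest n k t 𝓕)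
    (hi : i ∈ Icc 1 n) (hj : j ∈ Icc 1 n)
    (hT : ∀ T : Finset ℕ, (∀ A ∈ shift i j 𝓕, T ⊆ A) → #T < t) :
    IsLargest n k t (shift i j 𝓕) :=
  ⟨⟨subset_of_mem_shift hi hj h.1.subset, card_of_mem_shift h.1.card_eq,
    le_card_inter_of_mem_shift h.1.le_card_inter, hT⟩, fun 𝓖 h𝓖 =>
    (h.2 𝓖 h𝓖).trans (card_shift i j 𝓕).ge⟩

/-- The image of a family under a permutation of the ground set. -/
def permute (σ : Equiv.Perm ℕ) (𝓕 : Finset (Finset ℕ)) : Finset (Finset ℕ) :=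
  𝓕.image (fun A => A.image σ)

theorem card_permute (σ : Equiv.Perm ℕ) (𝓕 : Finset (Finset ℕ)) : #(permute σ 𝓕) = #𝓕 :=
  card_image_of_injective _ (image_injective σ.injective)

theorem permute_permute (σ τ : Equiv.Perm ℕ) (𝓕 : Finset (Finset ℕ)) :
    permute σ (permute τ 𝓕) = permute (σ * τ) 𝓕 := by
  simp only [permute, image_image]
  congr 1
  funext A
  simp [Function.comp_def, image_image]

theorem permute_one (𝓕 : Finset (Finset ℕ)) : permute 1 𝓕 = 𝓕 := by
  simp [permute]

/-- A permutation fixing everything outside `V` preserves `V`. -/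
theorem perm_mem {V : Finset ℕ} {σ : Equiv.Perm ℕ} (hσ : ∀ x, x ∉ V → σ x = x) {x : ℕ}
    (hx : x ∈ V) : σ x ∈ V := by
  by_contra h
  have := σ.injective (hσ _ h)
  exact h (by rw [this]; exact hx)

theorem perm_symm_fix {V : Finset ℕ} {σ : Equiv.Perm ℕ} (hσ : ∀ x, x ∉ V → σ x = x) :
    ∀ x, x ∉ V → σ.symm x = x := by
  intro x hx
  rw [Equiv.symm_apply_eq, hσ x hx]

theorem image_perm_subset {V A : Finset ℕ} {σ : Equiv.Perm ℕ} (hσ : ∀ x, x ∉ V → σ x = x)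
    (hA : A ⊆ V) : A.image σ ⊆ V := by
  intro x hx
  obtain ⟨y, hy, rfl⟩ := mem_image.1 hx
  exact perm_mem hσ (hA hy)

theorem NontrivialIntersecting.permute {n k t : ℕ} {𝓕 : Finset (Finset ℕ)}
    (h : NontrivialIntersecting n k t 𝓕) {σ : Equiv.Perm ℕ}
    (hσ : ∀ x, x ∉ Icc 1 n → σ x = x) : NontrivialIntersecting n k t (permute σ 𝓕) := by
  have hmem : ∀ A ∈ 𝓕, A.image σ ∈ _root_.permute σ 𝓕 := fun A hA => mem_image_of_mem _ hA
  refine ⟨?_, ?_, ?_, ?_⟩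
  · simp only [_root_.permute, forall_mem_image]
    exact fun A hA => image_perm_subset hσ (h.subset A hA)
  · simp only [_root_.permute, forall_mem_image]
    exact fun A hA => by rw [card_image_of_injective _ σ.injective, h.card_eq A hA]
  · simp only [_root_.permute, forall_mem_image]
    intro A hA B hB
    rw [← image_inter _ _ σ.injective, card_image_of_injective _ σ.injective]
    exact h.le_card_inter A hA B hB
  · intro T hT
    rw [← card_image_of_injective T σ.symm.injective]
    refine h.card_lt _ fun A hA x hx => ?_
    obtain ⟨y, hy, rfl⟩ := mem_image.1 hx
    exact mem_image_perm.1 (hT _ (hmem A hA) hy)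

theorem IsLargest.permute {n k t : ℕ} {𝓕 : Finset (Finset ℕ)}
    (h : IsLargest n k t 𝓕) {σ : Equiv.Perm ℕ}
    (hσ : ∀ x, x ∉ Icc 1 n → σ x = x) : IsLargest n k t (permute σ 𝓕) :=
  ⟨h.1.permute hσ, fun 𝓖 h𝓖 => (h.2 𝓖 h𝓖).trans (card_permute σ 𝓕).ge⟩

theorem exists_perm_image_eq {V S S' : Finset ℕ} (hS : S ⊆ V) (hS' : S' ⊆ V) (h : #S = #S') :
    ∃ σ : Equiv.Perm ℕ, (∀ x, x ∉ V → σ x = x) ∧ S.image σ = S' := by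
  induction hm : #(S \ S') generalizing S with
  | zero =>
    have h1 : S ⊆ S' := by rwa [card_eq_zero, sdiff_eq_empty_iff_subset] at hm
    exact ⟨1, by simp, by simpa using eq_of_subset_of_card_le h1 h.ge⟩
  | succ m ih =>
    obtain ⟨x, hx⟩ : (S \ S').Nonempty := card_pos.1 (by omega)
    obtain ⟨y, hy⟩ : (S' \ S).Nonempty := by
      rw [← card_pos]
      have := card_sdiff_add_card_inter S S'
      have := card_sdiff_add_card_inter S' S
      rw [inter_comm] at this
      omega
    simp only [mem_sdiff] at hx hy
    have hsub : exchange x y S ⊆ V := by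
      clear ih hm h
      intro z hz
      grind [mem_exchange]
    have hcard : #(exchange x y S \ S') = m := by
      have : exchange x y S \ S' = (S \ S').erase x := by
        clear ih hm h hsub
        ext z
        grind [mem_exchange]
      rw [this, card_erase_of_mem (by simp [hx]), hm]
      rfl
    obtain ⟨σ, h1, h2⟩ := ih hsub (by rw [card_exchange, h]) hcard
    refine ⟨σ * Equiv.swap x y, fun z hz => ?_, ?_⟩
    · rw [Equiv.Perm.mul_apply, Equiv.swap_apply_of_ne_of_ne, h1 z hz]
      · rintro rfl
        exact hz (hS hx.1)
      · rintro rfl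
        exact hz (hS' hy.1)
    · rw [← h2, exchange, image_image]
      rfl

theorem exists_perm_image_eq_Icc {n p q : ℕ} {T Z : Finset ℕ} (hT : T ⊆ Icc 1 n)
    (hZ : Z ⊆ Icc 1 n) (hTZ : Disjoint T Z) (hp : #T = p) (hq : #Z = q) :
    ∃ σ : Equiv.Perm ℕ, (∀ x, x ∉ Icc 1 n → σ x = x) ∧ T.image σ = Icc 1 p ∧
      Z.image σ = Icc (p + 1) (p + q) := by
  have hpq : p + q ≤ n := by
    have := card_le_card (union_subset hT hZ)
    rw [card_union_of_disjoint hTZ] at this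
    simpa [hp, hq] using this
  obtain ⟨σ, h1, h2⟩ := exists_perm_image_eq hT
    (Icc_subset_Icc_right (by omega) : Icc 1 p ⊆ Icc 1 n) (by simp [hp])
  have hZ' : Z.image σ ⊆ Icc (p + 1) n := by
    intro x hx
    have hx1 := image_perm_subset h1 hZ hx
    have hx2 : x ∉ Icc 1 p := by
      rw [← h2]
      exact disjoint_right.1 ((disjoint_image σ.injective).2 hTZ) hx
    simp only [mem_Icc] at *
    omega
  obtain ⟨τ, h3, h4⟩ := exists_perm_image_eq hZ'
    (Icc_subset_Icc_right (by omega) : Icc (p + 1) (p + q) ⊆ Icc (p + 1) n)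
    (by rw [card_image_of_injective _ σ.injective]; simp [hq])
  refine ⟨τ * σ, fun x hx => ?_, ?_, ?_⟩
  · rw [Equiv.Perm.mul_apply, h1 x hx, h3]
    simp only [mem_Icc] at *
    omega
  · have : (T.image σ).image τ = Icc 1 p := by
      rw [h2]
      conv_rhs => rw [← image_id (s := Icc 1 p)]
      refine image_congr fun x hx => h3 x ?_
      simp at hx ⊢
      omega
    rw [← this, image_image]
    rfl
  · rw [← h4, image_image]
    rfl

/-- The `k`-subsets of `[n]` that contain `T` and meet `Z`, or contain `Z` and all of `T` but at
most one element. Both extremal configurations are of this shape. -/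
def standardFamily (n k : ℕ) (T Z : Finset ℕ) : Finset (Finset ℕ) :=
  {A ∈ (Icc 1 n).powersetCard k |
    (T ⊆ A ∧ (A ∩ Z).Nonempty) ∨ (Z ⊆ A ∧ #T ≤ #(A ∩ T) + 1)}

theorem mem_standardFamily {n k : ℕ} {T Z A : Finset ℕ} :
    A ∈ standardFamily n k T Z ↔ (A ⊆ Icc 1 n ∧ #A = k) ∧
      ((T ⊆ A ∧ (A ∩ Z).Nonempty) ∨ (Z ⊆ A ∧ #T ≤ #(A ∩ T) + 1)) := by
  rw [standardFamily, mem_filter, mem_powersetCard]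

theorem permute_standardFamily {n k : ℕ} {T Z : Finset ℕ} {σ : Equiv.Perm ℕ}
    (hσ : ∀ x, x ∉ Icc 1 n → σ x = x) :
    permute σ (standardFamily n k T Z) = standardFamily n k (T.image σ) (Z.image σ) := by
  have key : ∀ (τ : Equiv.Perm ℕ) (T Z : Finset ℕ), (∀ x, x ∉ Icc 1 n → τ x = x) →
      ∀ A ∈ standardFamily n k T Z, A.image τ ∈ standardFamily n k (T.image τ) (Z.image τ) := by
    intro τ T Z hτ A hA
    rw [mem_standardFamily] at hA ⊢
    rw [← image_inter _ _ τ.injective, ← image_inter _ _ τ.injective, image_nonempty,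
      card_image_of_injective _ τ.injective, card_image_of_injective _ τ.injective,
      card_image_of_injective _ τ.injective, image_subset_image_iff τ.injective,
      image_subset_image_iff τ.injective]
    exact ⟨⟨image_perm_subset hτ hA.1.1, hA.1.2⟩, hA.2⟩
  have inv : ∀ B : Finset ℕ, (B.image σ.symm).image σ = B := fun B => by simp [image_image]
  have inv' : ∀ B : Finset ℕ, (B.image σ).image σ.symm = B := fun B => by simp [image_image]
  ext A
  simp only [permute, mem_image]
  constructor
  · rintro ⟨B, hB, rfl⟩
    exact key σ T Z hσ B hB
  · intro hA
    refine ⟨_, ?_, inv A⟩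
    have := key σ.symm _ _ (perm_symm_fix hσ) A hA
    rwa [inv', inv'] at this

theorem card_inter_add_card_inter_le (A B T : Finset ℕ) :
    #(A ∩ T) + #(B ∩ T) ≤ #T + #(A ∩ B ∩ T) := by
  have h1 := card_union_add_card_inter (A ∩ T) (B ∩ T)
  have h2 : A ∩ T ∩ (B ∩ T) = A ∩ B ∩ T := by ext x; simp
  have h3 : #(A ∩ T ∪ B ∩ T) ≤ #T :=
    card_le_card (union_subset inter_subset_right inter_subset_right)
  rw [h2] at h1
  omega

theorem card_inter_add_card_inter_le_of_disjoint {T Z : Finset ℕ} (h : Disjoint T Z)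
    (A : Finset ℕ) : #(A ∩ T) + #(A ∩ Z) ≤ #A := by
  rw [← card_union_of_disjoint (h.mono inter_subset_right inter_subset_right)]
  exact card_le_card (union_subset inter_subset_left inter_subset_left)

theorem nontrivialIntersecting_standardFamily {n k t : ℕ} {T Z : Finset ℕ} (hT : T ⊆ Icc 1 n)
    (hZ : Z ⊆ Icc 1 n) (hTZ : Disjoint T Z) (hTt : #T = t) (ht : 1 ≤ t) (hZ2 : 2 ≤ #Z)
    (hZk : t + #Z ≤ k + 1) (hk : t + 1 ≤ k) (hkn : k + 1 ≤ n) :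
    NontrivialIntersecting n k t (standardFamily n k T Z) := by
  refine ⟨fun A hA => (mem_standardFamily.1 hA).1.1, fun A hA => (mem_standardFamily.1 hA).1.2,
    ?_, ?_⟩
  · intro A hA B hB
    have hA := (mem_standardFamily.1 hA).2
    have hB := (mem_standardFamily.1 hB).2
    have h1 := card_inter_add_card_inter_le A B T
    have h2 := card_inter_add_card_inter_le_of_disjoint hTZ (A ∩ B)
    have hsT : ∀ {C : Finset ℕ}, T ⊆ C → #(C ∩ T) = #T := fun h => by
      rw [inter_eq_right.2 h]
    have h3 : Z ⊆ A → (B ∩ Z).Nonempty → 1 ≤ #(A ∩ B ∩ Z) := fun h h' =>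
      card_pos.2 (h'.mono fun x hx => by
        rw [mem_inter] at hx
        simp [hx, h hx.2])
    have h4 : Z ⊆ B → (A ∩ Z).Nonempty → 1 ≤ #(A ∩ B ∩ Z) := fun h h' =>
      card_pos.2 (h'.mono fun x hx => by
        rw [mem_inter] at hx
        simp [hx, h hx.2])
    have h5 : Z ⊆ A → Z ⊆ B → 2 ≤ #(A ∩ B ∩ Z) := fun h h' => by
      rwa [inter_eq_right.2 (subset_inter h h')]
    rcases hA with hA | hA <;> rcases hB with hB | hB
    · have := hsT hA.1
      have := hsT hB.1
      omega
    · have := hsT hA.1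
      have := h4 hB.1 hA.2
      omega
    · have := hsT hB.1
      have := h3 hA.1 hB.2
      omega
    · have := h5 hA.1 hB.1
      omega
  · intro S hS
    suffices S = ∅ by
      rw [this, card_empty]
      omega
    rw [eq_empty_iff_forall_notMem]
    intro x hx
    have hcard : k ≤ #((Icc 1 n).erase x) := by
      have := pred_card_le_card_erase (s := Icc 1 n) (a := x)
      simp only [Nat.card_Icc] at this
      omega
    by_cases hxT : x ∈ T
    · obtain ⟨B, hB1, hB2, hB3⟩ := exists_subsuperset_card_eq
        (s := T.erase x ∪ Z) (t := (Icc 1 n).erase x) (n := k) (by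
          intro y hy
          have := disjoint_left.1 hTZ hxT
          have := @hT y
          have := @hZ y
          grind) (by
          have := card_union_le (T.erase x) Z
          rw [card_erase_of_mem hxT] at this
          omega) hcard
      have hB : B ∈ standardFamily n k T Z := by
        refine mem_standardFamily.2 ⟨⟨hB2.trans (erase_subset _ _), hB3⟩, Or.inr ⟨?_, ?_⟩⟩
        · exact subset_union_right.trans hB1
        · have : T.erase x ⊆ B ∩ T :=
            subset_inter (subset_union_left.trans hB1) (erase_subset _ _)
          have := card_le_card this
          rw [card_erase_of_mem hxT] at this
          omega
      exact notMem_erase x _ (hB2 (hS B hB hx))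
    · obtain ⟨z, hz⟩ : (Z.erase x).Nonempty := by
        rw [← card_pos]
        have := pred_card_le_card_erase (s := Z) (a := x)
        omega
      rw [mem_erase] at hz
      obtain ⟨B, hB1, hB2, hB3⟩ := exists_subsuperset_card_eq
        (s := insert z T) (t := (Icc 1 n).erase x) (n := k) (by
          intro y hy
          have := @hT y
          have := @hZ y
          grind) ((card_insert_le _ _).trans (by omega)) hcard
      have hB : B ∈ standardFamily n k T Z := by
        refine mem_standardFamily.2 ⟨⟨hB2.trans (erase_subset _ _), hB3⟩, Or.inl ⟨?_, z, ?_⟩⟩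
        · exact (subset_insert _ _).trans hB1
        · exact mem_inter.2 ⟨hB1 (mem_insert_self _ _), hz.2⟩
      exact notMem_erase x _ (hB2 (hS B hB hx))

theorem card_filter_inter_eq {V S D : Finset ℕ} {k : ℕ} (hDS : D ⊆ S) (hSV : S ⊆ V)
    (hD : #D ≤ k) :
    #{B ∈ V.powersetCard k | B ∩ S = D} = (#V - #S).choose (k - #D) := by
  rw [← card_sdiff_of_subset hSV, ← card_powersetCard]
  refine card_bij' (fun B _ => B \ S) (fun C _ => D ∪ C) ?_ ?_ ?_ ?_
  · intro B hB
    rw [mem_filter, mem_powersetCard] at hB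
    rw [mem_powersetCard]
    refine ⟨sdiff_subset_sdiff hB.1.1 subset_rfl, ?_⟩
    have := card_sdiff_add_card_inter B S
    rw [hB.2] at this
    omega
  · intro C hC
    rw [mem_powersetCard] at hC
    have hCS : Disjoint C S := disjoint_of_subset_left hC.1 sdiff_disjoint
    rw [mem_filter, mem_powersetCard]
    refine ⟨⟨union_subset (hDS.trans hSV) (hC.1.trans sdiff_subset), ?_⟩, ?_⟩
    · rw [card_union_of_disjoint (disjoint_of_subset_right hDS hCS).symm]
      omega
    · rw [union_inter_distrib_right, inter_eq_left.2 hDS, disjoint_iff_inter_eq_empty.1 hCS,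
        union_empty]
  · intro B hB
    rw [mem_filter] at hB
    simp only [← hB.2]
    ext x
    simp only [mem_union, mem_inter, mem_sdiff]
    tauto
  · intro C hC
    rw [mem_powersetCard] at hC
    ext x
    have h1 := @hC.1 x
    have h2 := @hDS x
    simp only [mem_union, mem_sdiff] at *
    tauto

/-- How the size of a standard family changes when `Z` gains an element. -/
theorem card_standardFamily_insert {n k w : ℕ} {T Z : Finset ℕ} (hT : T ⊆ Icc 1 n)
    (hZ : Z ⊆ Icc 1 n) (hw : w ∈ Icc 1 n) (hTZ : Disjoint T Z) (hwT : w ∉ T) (hwZ : w ∉ Z)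
    (hTn : T.Nonempty) (hZn : Z.Nonempty) (hTk : #T + 1 ≤ k) (hZk : #T + #Z ≤ k + 1) :
    #(standardFamily n k T (insert w Z)) +
        #T * (n - #T - #Z - 1).choose (k + 1 - #T - #Z) =
      #(standardFamily n k T Z) + (n - #T - #Z - 1).choose (k - #T - 1) := by
  have hS : insert w (T ∪ Z) ⊆ Icc 1 n :=
    insert_subset hw (union_subset hT hZ)
  have hScard : #(insert w (T ∪ Z)) = #T + #Z + 1 := by
    rw [card_insert_of_notMem (by simp [hwT, hwZ]), card_union_of_disjoint hTZ]
  have hT1 : 1 ≤ #T := hTn.card_pos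
  have h1 : standardFamily n k T (insert w Z) \ standardFamily n k T Z =
      {B ∈ (Icc 1 n).powersetCard k | B ∩ insert w (T ∪ Z) = insert w T} := by
    ext B
    simp only [mem_sdiff, mem_standardFamily, mem_filter, mem_powersetCard]
    constructor
    · rintro ⟨⟨hB, h1 | h1⟩, h2⟩
      · refine ⟨hB, ?_⟩
        have h3 : ¬ (B ∩ Z).Nonempty := fun h => h2 ⟨hB, Or.inl ⟨h1.1, h⟩⟩
        rw [not_nonempty_iff_eq_empty] at h3
        have h4 : w ∈ B := by
          by_contra hw'
          rw [inter_insert_of_notMem hw', h3] at h1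
          exact not_nonempty_empty h1.2
        rw [inter_insert_of_mem h4, inter_union_distrib_left, h3, union_empty,
          inter_eq_right.2 h1.1]
      · exact absurd ⟨hB, Or.inr ⟨(subset_insert _ _).trans h1.1, h1.2⟩⟩ h2
    · rintro ⟨hB, h1⟩
      have hTB : T ⊆ B := fun x hx => by
        have : x ∈ B ∩ insert w (T ∪ Z) := by rw [h1]; exact mem_insert_of_mem hx
        exact (mem_inter.1 this).1
      have hwB : w ∈ B := by
        have : w ∈ B ∩ insert w (T ∪ Z) := by rw [h1]; exact mem_insert_self _ _
        exact (mem_inter.1 this).1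
      have hZB : ∀ x ∈ Z, x ∉ B := fun x hx hxB => by
        have h2 : x ∈ B ∩ insert w (T ∪ Z) := by simp [hx, hxB]
        rw [h1, mem_insert] at h2
        rcases h2 with rfl | h2
        · exact hwZ hx
        · exact disjoint_left.1 hTZ h2 hx
      refine ⟨⟨hB, Or.inl ⟨hTB, w, by simp [hwB]⟩⟩, ?_⟩
      rintro ⟨-, ⟨-, x, hx⟩ | ⟨h2, h3⟩⟩
      · rw [mem_inter] at hx
        exact hZB x hx.2 hx.1
      · obtain ⟨x, hx⟩ := hZn
        exact hZB x hx (h2 hx)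
  have h2 : standardFamily n k T Z \ standardFamily n k T (insert w Z) =
      T.biUnion fun x =>
        {B ∈ (Icc 1 n).powersetCard k | B ∩ insert w (T ∪ Z) = T.erase x ∪ Z} := by
    ext B
    simp only [mem_sdiff, mem_standardFamily, mem_filter, mem_powersetCard, mem_biUnion]
    constructor
    · rintro ⟨⟨hB, h3⟩, h4⟩
      have hTB : ¬ T ⊆ B := fun h => by
        refine h4 ⟨hB, Or.inl ⟨h, ?_⟩⟩
        rcases h3 with h3 | h3
        · exact h3.2.mono (inter_subset_inter_left (subset_insert _ _))
        · obtain ⟨x, hx⟩ := hZn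
          exact ⟨x, by simp [h3.1 hx, hx]⟩
      have h3 := h3.resolve_left fun h => hTB h.1
      have hwB : w ∉ B := fun h => h4 ⟨hB, Or.inr ⟨insert_subset h h3.1, h3.2⟩⟩
      have hx1 : #(T \ B) = 1 := by
        have h5 := card_sdiff_add_card_inter T B
        have h6 := card_pos.2 (sdiff_nonempty.2 hTB)
        rw [inter_comm] at h5
        omega
      obtain ⟨x, hx⟩ := card_eq_one.1 hx1
      have hx' : ∀ y, y ∈ T ∧ y ∉ B ↔ y = x := fun y => by
        rw [← mem_sdiff, hx, mem_singleton]
      refine ⟨x, ((hx' x).2 rfl).1, hB, ?_⟩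
      ext y
      have := hx' y
      have := @h3.1 y
      simp only [mem_inter, mem_insert, mem_union, mem_erase]
      constructor
      · rintro ⟨h7, rfl | h8 | h8⟩
        · exact absurd h7 hwB
        · exact Or.inl ⟨fun h => ((hx' y).2 h).2 h7, h8⟩
        · exact Or.inr h8
      · tauto
    · rintro ⟨x, hx, hB, h3⟩
      have hmem : ∀ y ∈ insert w (T ∪ Z), y ∈ B ↔ y ∈ T.erase x ∪ Z := fun y hy => by
        rw [← h3, mem_inter]
        tauto
      have hxB : x ∉ B := by
        rw [hmem x (by simp [hx])]
        simp [disjoint_left.1 hTZ hx]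
      have hwB : w ∉ B := by
        rw [hmem w (by simp)]
        simp [hwT, hwZ]
      refine ⟨⟨hB, Or.inr ⟨fun y hy => ?_, ?_⟩⟩, ?_⟩
      · rw [hmem y (by simp [hy])]
        simp [hy]
      · have : T.erase x ⊆ B ∩ T := fun y hy => by
          have hyT := mem_of_mem_erase hy
          rw [mem_inter, hmem y (by simp [hyT])]
          exact ⟨mem_union_left _ hy, hyT⟩
        have := card_le_card this
        rw [card_erase_of_mem hx] at this
        omega
      · rintro ⟨-, h | h⟩
        · exact hxB (h.1 hx)
        · exact hwB (h.1 (mem_insert_self _ _))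
  have h3 : #(standardFamily n k T (insert w Z) \ standardFamily n k T Z) =
      (n - #T - #Z - 1).choose (k - #T - 1) := by
    rw [h1, card_filter_inter_eq (insert_subset_insert _ subset_union_left) hS
      (by rw [card_insert_of_notMem hwT]; exact hTk), hScard, card_insert_of_notMem hwT]
    simp [Nat.sub_sub, add_assoc]
  have h4 : #(standardFamily n k T Z \ standardFamily n k T (insert w Z)) =
      #T * (n - #T - #Z - 1).choose (k + 1 - #T - #Z) := by
    rw [h2, card_biUnion]
    · rw [← smul_eq_mul, ← sum_const]
      refine sum_congr rfl fun x hx => ?_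
      have hD : #(T.erase x ∪ Z) = #T - 1 + #Z := by
        rw [card_union_of_disjoint (disjoint_of_subset_left (erase_subset _ _) hTZ),
          card_erase_of_mem hx]
      rw [card_filter_inter_eq (union_subset ((erase_subset _ _).trans
        (subset_union_left.trans (subset_insert _ _)))
        (subset_union_right.trans (subset_insert _ _))) hS (by rw [hD]; omega), hScard, hD,
        Nat.card_Icc]
      congr 1 <;> omega
    · intro x hx y hy hxy
      refine disjoint_left.2 fun B hB hB' => ?_
      rw [mem_filter] at hB hB'
      have h5 := hB.2.symm.trans hB'.2
      have h6 : x ∈ T.erase y ∪ Z := by simp [mem_coe.1 hx, hxy]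
      rw [← h5] at h6
      simp [disjoint_left.1 hTZ (mem_coe.1 hx)] at h6
  have h5 := card_sdiff_add_card_inter (standardFamily n k T Z)
    (standardFamily n k T (insert w Z))
  have h6 := card_sdiff_add_card_inter (standardFamily n k T (insert w Z))
    (standardFamily n k T Z)
  rw [inter_comm] at h6
  omega

/-- A standard family of the largest size is extremal in `#Z`. -/
theorem card_eq_of_isLargest_standardFamily {n k t : ℕ} {T Z : Finset ℕ} (hT : T ⊆ Icc 1 n)
    (hZ : Z ⊆ Icc 1 n) (hTZ : Disjoint T Z) (hTt : #T = t) (ht : 1 ≤ t) (hZ2 : 2 ≤ #Z)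
    (hZk : t + #Z ≤ k + 1) (hk : t + 2 ≤ k) (hn : 2 * k + 2 ≤ n + t)
    (h : IsLargest n k t (standardFamily n k T Z)) : #Z = 2 ∨ t + #Z = k + 1 := by
  by_contra hc
  rw [not_or] at hc
  obtain ⟨w, hw⟩ : (Icc 1 n \ (T ∪ Z)).Nonempty := by
    rw [← card_pos, card_sdiff_of_subset (union_subset hT hZ), card_union_of_disjoint hTZ,
      Nat.card_Icc]
    omega
  simp only [mem_sdiff, mem_union, not_or] at hw
  obtain ⟨z, hz⟩ : Z.Nonempty := card_pos.1 (by omega)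
  have hTn : T.Nonempty := card_pos.1 (by omega)
  have hzc : #(Z.erase z) = #Z - 1 := card_erase_of_mem hz
  have h1 := card_standardFamily_insert (k := k) hT hZ hw.1 hTZ hw.2.1 hw.2.2 hTn ⟨z, hz⟩
    (by omega) (by omega)
  have h2 := card_standardFamily_insert (k := k) (w := z) hT ((erase_subset z Z).trans hZ) (hZ hz)
    (disjoint_of_subset_right (erase_subset _ _) hTZ) (disjoint_right.1 hTZ hz)
    (notMem_erase _ _) hTn (card_pos.1 (by omega)) (by omega) (by omega)
  rw [insert_erase hz] at h2
  have h3 := h.2 _ (nontrivialIntersecting_standardFamily (k := k) (Z := insert w Z) hT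
    (insert_subset hw.1 hZ) (disjoint_insert_right.2 ⟨hw.2.1, hTZ⟩) hTt ht
    (by rw [card_insert_of_notMem hw.2.2]; omega) (by rw [card_insert_of_notMem hw.2.2]; omega)
    (by omega) (by omega))
  have h4 := h.2 _ (nontrivialIntersecting_standardFamily (k := k) hT
    ((erase_subset z Z).trans hZ)
    (disjoint_of_subset_right (erase_subset _ _) hTZ) hTt ht
    (by omega) (by omega) (by omega) (by omega))
  obtain ⟨N, hN⟩ : ∃ N, n - #T - #Z - 1 = N := ⟨_, rfl⟩
  obtain ⟨p, hp⟩ : ∃ p, k - #T - 1 = p := ⟨_, rfl⟩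
  obtain ⟨q, hq⟩ : ∃ q, k + 1 - #T - #Z = q := ⟨_, rfl⟩
  have e1 : n - #T - #(Z.erase z) - 1 = N + 1 := by omega
  have e2 : k + 1 - #T - #(Z.erase z) = q + 1 := by omega
  rw [hN, hp, hq] at h1
  rw [e1, e2, hp] at h2
  have h5 : N.choose p ≤ #T * N.choose q := by omega
  have h6 : #T * (N + 1).choose (q + 1) ≤ (N + 1).choose p := by omega
  have h7 := Nat.add_one_mul_choose_eq N q
  have h8 := Nat.choose_mul_succ_eq N p
  have hpos : 0 < #T * N.choose q :=
    Nat.mul_pos (by omega) (Nat.choose_pos (by omega))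
  have h9 : q + 1 < N + 1 - p := by omega
  have h10 : (N + 1) * (#T * N.choose q) = (#T * (N + 1).choose (q + 1)) * (q + 1) := by
    rw [mul_left_comm, h7, mul_assoc]
  have h11 : (#T * (N + 1).choose (q + 1)) * (N + 1 - p) ≤ (N + 1) * (#T * N.choose q) := by
    calc _ ≤ (N + 1).choose p * (N + 1 - p) := Nat.mul_le_mul_right _ h6
      _ = N.choose p * (N + 1) := h8.symm
      _ ≤ (#T * N.choose q) * (N + 1) := Nat.mul_le_mul_right _ h5
      _ = _ := mul_comm _ _
  rw [h10] at h11
  have h12 : 0 < #T * (N + 1).choose (q + 1) := by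
    by_contra h0
    have : #T * (N + 1).choose (q + 1) = 0 := by omega
    rw [this, zero_mul] at h10
    have := Nat.mul_pos (Nat.succ_pos N) hpos
    simp only [Nat.succ_eq_add_one] at this
    omega
  have := Nat.le_of_mul_le_mul_left h11 h12
  omega

/-- Connectivity of bipartite Kneser graphs: if disjoint `p`- and `q`-subsets of `W` always get
the same truth value, and `#W > p + q`, then all of them do. -/
theorem iff_of_forall_disjoint_iff {W : Finset ℕ} {p q : ℕ} (hW : p + q + 1 ≤ #W)
    {P Q : Finset ℕ → Prop}
    (h : ∀ S ⊆ W, ∀ S' ⊆ W, #S = p → #S' = q → Disjoint S S' → (P S ↔ Q S'))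
    {S S' : Finset ℕ} (hS : S ⊆ W) (hS' : S' ⊆ W) (hSp : #S = p) (hSq : #S' = q) :
    P S ↔ Q S' := by
  have key : ∀ m : ℕ, ∀ S₁ ⊆ W, ∀ S₂ ⊆ W, #S₁ = p → #S₂ = p → #(S₁ \ S₂) = m →
      (P S₁ ↔ P S₂) := by
    intro m
    induction m with
    | zero =>
      intro S₁ _ S₂ _ h1 h2 hm
      rw [card_eq_zero, sdiff_eq_empty_iff_subset] at hm
      rw [eq_of_subset_of_card_le hm (by omega)]
    | succ m ih =>
      intro S₁ hS₁ S₂ hS₂ h1 h2 hm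
      obtain ⟨x, hx⟩ : (S₁ \ S₂).Nonempty := card_pos.1 (by omega)
      obtain ⟨y, hy⟩ : (S₂ \ S₁).Nonempty := by
        rw [← card_pos]
        have h3 := card_sdiff_add_card_inter S₁ S₂
        have h4 := card_sdiff_add_card_inter S₂ S₁
        rw [inter_comm] at h4
        omega
      rw [mem_sdiff] at hx hy
      have hyc : y ∉ S₁.erase x := fun h => hy.2 (mem_of_mem_erase h)
      have hsub : insert y (S₁.erase x) ⊆ W :=
        insert_subset (hS₂ hy.1) ((erase_subset _ _).trans hS₁)
      have hc1 : #(insert y (S₁.erase x)) = p := by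
        have := card_pos.2 ⟨x, hx.1⟩
        rw [card_insert_of_notMem hyc, card_erase_of_mem hx.1]
        omega
      have hc2 : #(insert y (S₁.erase x) \ S₂) = m := by
        have : insert y (S₁.erase x) \ S₂ = (S₁ \ S₂).erase x := by
          ext z
          simp only [mem_sdiff, mem_insert, mem_erase]
          constructor
          · rintro ⟨rfl | h3, h4⟩
            · exact absurd hy.1 h4
            · exact ⟨h3.1, h3.2, h4⟩
          · tauto
        rw [this, card_erase_of_mem (mem_sdiff.2 hx), hm]
        rfl
      rw [← ih _ hsub S₂ hS₂ hc1 h2 hc2]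
      have hsub2 : insert y S₁ ⊆ W := insert_subset (hS₂ hy.1) hS₁
      obtain ⟨R, hR1, hR2⟩ := exists_subset_card_eq (s := W \ insert y S₁) (n := q) (by
        rw [card_sdiff_of_subset hsub2, card_insert_of_notMem hy.2]
        omega)
      have hd : Disjoint (insert y S₁) R := disjoint_of_subset_right hR1 disjoint_sdiff
      have hRW := hR1.trans sdiff_subset
      rw [h S₁ hS₁ R hRW h1 hR2 (disjoint_of_subset_left (subset_insert _ _) hd),
        h _ hsub R hRW hc1 hR2
          (disjoint_of_subset_left (insert_subset_insert _ (erase_subset _ _)) hd)]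
  obtain ⟨R, hR1, hR2⟩ := exists_subset_card_eq (s := W \ S') (n := p) (by
    rw [card_sdiff_of_subset hS']
    omega)
  have hRW := hR1.trans sdiff_subset
  rw [key _ S hS R hRW hSp hR2 rfl]
  exact h R hRW S' hS' hR2 hSq (disjoint_of_subset_left hR1 sdiff_disjoint)

/-- A family whose compression `𝒮` has only interchangeable changes is `𝒮` or its mirror image. -/
theorem eq_or_eq_image_exchange_of_shift_eq {i j : ℕ} {𝓖 𝒮 : Finset (Finset ℕ)}
    (h : shift i j 𝓖 = 𝒮)
    (hK : ∀ A ∈ 𝒮, i ∈ A → j ∉ A → exchange i j A ∉ 𝒮 →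
      ∀ B ∈ 𝒮, i ∈ B → j ∉ B → exchange i j B ∉ 𝒮 → A ∈ 𝓖 → B ∈ 𝓖) :
    𝓖 = 𝒮 ∨ 𝓖 = 𝒮.image (exchange i j) := by
  have hm : ∀ A, A ∈ 𝒮 ↔ (A ∈ 𝓖 ∧ ((j ∈ A ∧ i ∉ A) → exchange i j A ∈ 𝓖)) ∨
      (exchange i j A ∈ 𝓖 ∧ i ∈ A ∧ j ∉ A) := fun A => by
    rw [← h, mem_shift]
  have himg : ∀ A, A ∈ 𝒮.image (exchange i j) ↔ exchange i j A ∈ 𝒮 := fun A => by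
    rw [mem_image]
    constructor
    · rintro ⟨B, hB, rfl⟩
      rwa [exchange_exchange]
    · exact fun hA => ⟨_, hA, exchange_exchange i j A⟩
  have hex : ∀ A, (i ∈ exchange i j A ↔ j ∈ A) ∧ (j ∈ exchange i j A ↔ i ∈ A) := fun A => by
    rw [mem_exchange, mem_exchange]
    constructor <;> split_ifs <;> simp_all
  have hfix : ∀ A, (i ∈ A ↔ j ∈ A) → exchange i j A = A := fun A => exchange_eq_self
  have hmex : ∀ A, exchange i j A ∈ 𝒮 ↔ (exchange i j A ∈ 𝓖 ∧ ((i ∈ A ∧ j ∉ A) → A ∈ 𝓖)) ∨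
      (A ∈ 𝓖 ∧ j ∈ A ∧ i ∉ A) := fun A => by
    rw [hm, exchange_exchange, (hex A).1, (hex A).2]
  by_cases hc : ∃ A ∈ 𝒮, i ∈ A ∧ j ∉ A ∧ exchange i j A ∉ 𝒮 ∧ A ∈ 𝓖
  · obtain ⟨A₀, h1, h2, h3, h4, h5⟩ := hc
    have hK' := fun B a b c d => hK A₀ h1 h2 h3 h4 B a b c d h5
    left
    ext A
    have e1 := hm A
    have e2 := hmex A
    have e3 := hK' A
    have e4 := hK' (exchange i j A)
    have e5 := hfix A
    rw [(hex A).1, (hex A).2, exchange_exchange] at e4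
    clear hm hmex hK hK' h h1 h2 h3 h4 h5 hex himg hfix
    grind
  · right
    ext A
    rw [himg]
    have hc' : ∀ A ∈ 𝒮, i ∈ A → j ∉ A → exchange i j A ∉ 𝒮 → A ∉ 𝓖 :=
      fun A h1 h2 h3 h4 h5 => hc ⟨A, h1, h2, h3, h4, h5⟩
    have e1 := hm A
    have e2 := hmex A
    have e3 := hc' A
    have e4 := hc' (exchange i j A)
    have e5 := hfix A
    rw [(hex A).1, (hex A).2, exchange_exchange] at e4
    clear hm hmex hK hc hc' h hex himg hfix
    grind

/-- `A` is a member of `𝒮` that leaves `𝒮` when `i` is replaced by `j`. -/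
def Movable (i j : ℕ) (𝒮 : Finset (Finset ℕ)) (A : Finset ℕ) : Prop :=
  A ∈ 𝒮 ∧ i ∈ A ∧ j ∉ A ∧ exchange i j A ∉ 𝒮

theorem erase_subset_of_card_le {A T : Finset ℕ} {x : ℕ} (h : #T ≤ #(A ∩ T) + 1) (hx : x ∈ T)
    (hxA : x ∉ A) : T.erase x ⊆ A := by
  have h1 : A ∩ T ⊆ T.erase x := fun y hy => by
    rw [mem_inter] at hy
    exact mem_erase.2 ⟨fun h => hxA (h ▸ hy.1), hy.2⟩
  have h2 := eq_of_subset_of_card_le h1 (by rw [card_erase_of_mem hx]; omega)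
  rw [← h2]
  exact inter_subset_left

theorem exchange_eq_insert_erase' {i j : ℕ} {A : Finset ℕ} (hi : i ∈ A) (hj : j ∉ A) :
    exchange i j A = insert j (A.erase i) := by
  ext x
  grind [mem_exchange]

theorem not_movable {n k i j : ℕ} {T Z : Finset ℕ} (hTZ : Disjoint T Z) (hZ2 : 2 ≤ #Z)
    (hi : i ∈ Icc 1 n) (hj : j ∈ Icc 1 n) (h1 : ¬ (i ∈ Z ∧ j ∉ T ∧ j ∉ Z))
    (h2 : ¬ (i ∈ T ∧ j ∉ T)) (A : Finset ℕ) : ¬ Movable i j (standardFamily n k T Z) A := by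
  rintro ⟨hA, hiA, hjA, hne⟩
  refine hne ?_
  have hbase := exchange_subset hi hj (mem_standardFamily.1 hA).1.1
  have hbase2 := (card_exchange i j A).trans (mem_standardFamily.1 hA).1.2
  by_cases hsame : (i ∈ T ↔ j ∈ T) ∧ (i ∈ Z ↔ j ∈ Z)
  · have h3 : permute (Equiv.swap i j) (standardFamily n k T Z) = standardFamily n k T Z := by
      rw [permute_standardFamily]
      · change standardFamily n k (exchange i j T) (exchange i j Z) = _
        rw [exchange_eq_self hsame.1, exchange_eq_self hsame.2]
      · intro x hx
        exact Equiv.swap_apply_of_ne_of_ne (fun h => hx (h ▸ hi)) (fun h => hx (h ▸ hj))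
    rw [← h3]
    exact mem_image_of_mem _ hA
  · have hiT : i ∉ T := fun h => by
      have h3 : j ∈ T := by tauto
      have := disjoint_left.1 hTZ h
      have := disjoint_left.1 hTZ h3
      tauto
    have hA2 := (mem_standardFamily.1 hA).2
    rw [mem_standardFamily]
    refine ⟨⟨hbase, hbase2⟩, Or.inl ?_⟩
    rw [exchange_eq_insert_erase' hiA hjA]
    by_cases hjT : j ∈ T
    · have hA3 := hA2.resolve_left fun h => hjA (h.1 hjT)
      have hA4 := erase_subset_of_card_le hA3.2 hjT hjA
      obtain ⟨z, hz⟩ : (Z.erase i).Nonempty := by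
        rw [← card_pos]
        have := pred_card_le_card_erase (s := Z) (a := i)
        omega
      rw [mem_erase] at hz
      refine ⟨fun x hx => ?_, z, ?_⟩
      · by_cases hxj : x = j
        · simp [hxj]
        · have := hA4 (mem_erase.2 ⟨hxj, hx⟩)
          have : x ≠ i := fun h => hiT (h ▸ hx)
          simp [*]
      · simp [hz.2, hz.1, hA3.1 hz.2]
    · have hjZ : j ∈ Z := by tauto
      have hA3 := hA2.resolve_right fun h => hjA (h.1 hjZ)
      refine ⟨fun x hx => ?_, j, by simp [hjZ]⟩
      have := hA3.1 hx
      have : x ≠ i := fun h => hiT (h ▸ hx)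
      simp [*]

/-- Movable members that barely meet after one of them is moved have the same label. -/
def Conflicting (t i j : ℕ) (𝒮 : Finset (Finset ℕ)) (P : Finset ℕ → Prop) : Prop :=
  ∀ A B, Movable i j 𝒮 A → Movable i j 𝒮 B → #(A ∩ exchange i j B) < t → (P A ↔ P B)

theorem Conflicting.iff_of_mem_right {n k t i j : ℕ} {T Z : Finset ℕ} {P : Finset ℕ → Prop}
    (hT : T ⊆ Icc 1 n) (hZ : Z ⊆ Icc 1 n) (hTZ : Disjoint T Z) (hTt : #T = t) (ht : 1 ≤ t)
    (hZk : t + #Z ≤ k + 1) (hk : t + 2 ≤ k) (hn : 2 * k + 2 ≤ n + t)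
    (hj : j ∈ Icc 1 n) (hiZ : i ∈ Z) (hjT : j ∉ T) (hjZ : j ∉ Z)
    (hP : Conflicting t i j (standardFamily n k T Z) P) {A B : Finset ℕ}
    (hA : Movable i j (standardFamily n k T Z) A)
    (hB : Movable i j (standardFamily n k T Z) B) : P A ↔ P B := by
  have hiT : i ∉ T := disjoint_right.1 hTZ hiZ
  have hij : i ≠ j := fun h => hjZ (h ▸ hiZ)
  obtain ⟨W, hW⟩ : ∃ W, W = Icc 1 n \ insert j (T ∪ Z) := ⟨_, rfl⟩
  have hWmem : ∀ x, x ∈ W ↔ x ∈ Icc 1 n ∧ x ≠ j ∧ x ∉ T ∧ x ∉ Z := fun x => by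
    rw [hW]
    simp only [mem_sdiff, mem_insert, mem_union]
    tauto
  have hWc : #W = n - t - #Z - 1 := by
    rw [hW, card_sdiff_of_subset (insert_subset hj (union_subset hT hZ)),
      card_insert_of_notMem (by simp [hjT, hjZ]), card_union_of_disjoint hTZ, Nat.card_Icc]
    omega
  have hα : ∀ S ⊆ W, #S = k - t - 1 → Movable i j (standardFamily n k T Z) (insert i (T ∪ S)) := by
    intro S hS hSc
    have hSW := fun x hx => (hWmem x).1 (hS hx)
    have hd : Disjoint T S := disjoint_right.2 fun x hx => (hSW x hx).2.2.1
    have hiS : i ∉ T ∪ S := by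
      rw [mem_union]
      exact fun h => h.elim hiT fun h => (hSW i h).2.2.2 hiZ
    have hjA : j ∉ insert i (T ∪ S) := by
      rw [mem_insert, mem_union]
      rintro (h | h | h)
      exacts [hij h.symm, hjT h, (hSW j h).2.1 rfl]
    refine ⟨mem_standardFamily.2 ⟨⟨?_, ?_⟩, Or.inl ⟨?_, i, by simp [hiZ]⟩⟩, by simp, hjA, ?_⟩
    · exact insert_subset (hZ hiZ) (union_subset hT fun x hx => (hSW x hx).1)
    · rw [card_insert_of_notMem hiS, card_union_of_disjoint hd]
      omega
    · exact subset_union_left.trans (subset_insert _ _)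
    · rw [exchange_eq_insert_erase' (mem_insert_self _ _) hjA, mem_standardFamily,
        erase_insert hiS]
      rintro ⟨-, ⟨-, y, hy⟩ | ⟨h, -⟩⟩
      · rw [mem_inter, mem_insert, mem_union] at hy
        rcases hy with ⟨rfl | h | h, h'⟩
        exacts [hjZ h', disjoint_left.1 hTZ h h', (hSW y h).2.2.2 h']
      · have := h hiZ
        rw [mem_insert] at this
        exact this.elim hij hiS
  have hβ : ∀ x ∈ T, ∀ S ⊆ W, #S = k + 1 - t - #Z →
      Movable i j (standardFamily n k T Z) (T.erase x ∪ Z ∪ S) := by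
    intro x hx S hS hSc
    have hSW := fun x hx => (hWmem x).1 (hS hx)
    have hd : Disjoint (T.erase x ∪ Z) S := by
      rw [disjoint_union_left]
      exact ⟨disjoint_right.2 fun y hy h => (hSW y hy).2.2.1 (mem_of_mem_erase h),
        disjoint_right.2 fun y hy => (hSW y hy).2.2.2⟩
    have hjA : j ∉ T.erase x ∪ Z ∪ S := by
      simp only [mem_union]
      rintro ((h | h) | h)
      exacts [hjT (mem_of_mem_erase h), hjZ h, (hSW j h).2.1 rfl]
    have hxA : x ∉ T.erase x ∪ Z ∪ S := by
      simp only [mem_union]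
      rintro ((h | h) | h)
      exacts [notMem_erase _ _ h, disjoint_left.1 hTZ hx h, (hSW x h).2.2.1 hx]
    have hiA : i ∈ T.erase x ∪ Z ∪ S := by simp [hiZ]
    refine ⟨mem_standardFamily.2 ⟨⟨?_, ?_⟩, Or.inr ⟨?_, ?_⟩⟩, hiA, hjA, ?_⟩
    · exact union_subset (union_subset ((erase_subset _ _).trans hT) hZ) fun x hx => (hSW x hx).1
    · rw [card_union_of_disjoint hd,
        card_union_of_disjoint (disjoint_of_subset_left (erase_subset _ _) hTZ),
        card_erase_of_mem hx]
      omega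
    · exact subset_union_right.trans subset_union_left
    · have : T.erase x ⊆ (T.erase x ∪ Z ∪ S) ∩ T :=
        subset_inter (subset_union_left.trans subset_union_left) (erase_subset _ _)
      have := card_le_card this
      rw [card_erase_of_mem hx] at this
      omega
    · rw [exchange_eq_insert_erase' hiA hjA, mem_standardFamily]
      rintro ⟨-, ⟨h, -⟩ | ⟨h, -⟩⟩
      · have := h hx
        rw [mem_insert, mem_erase] at this
        rcases this with rfl | h
        exacts [hjT hx, hxA h.2]
      · have := h hiZ
        rw [mem_insert] at this
        exact this.elim hij (notMem_erase _ _)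
  have hconf : ∀ x ∈ T, ∀ S ⊆ W, ∀ S' ⊆ W, Disjoint S S' →
      #((insert i (T ∪ S)) ∩ exchange i j (T.erase x ∪ Z ∪ S')) < t := by
    intro x hx S hS S' hS' hd
    have hsub : insert i (T ∪ S) ∩ exchange i j (T.erase x ∪ Z ∪ S') ⊆ T.erase x := by
      intro y hy
      rw [mem_inter, mem_exchange] at hy
      obtain ⟨h1, h2⟩ := hy
      have h3 : y ≠ i := by
        rintro rfl
        rw [if_pos rfl] at h2
        simp only [mem_union, mem_erase] at h2
        rcases h2 with (h | h) | h
        exacts [hjT h.2, hjZ h, ((hWmem j).1 (hS' h)).2.1 rfl]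
      have h1 : y ∈ T ∪ S := (mem_insert.1 h1).resolve_left h3
      have h4 : y ≠ j := by
        rintro rfl
        rcases mem_union.1 h1 with h | h
        exacts [hjT h, ((hWmem y).1 (hS h)).2.1 rfl]
      rw [if_neg h3, if_neg h4] at h2
      simp only [mem_union] at h1 h2
      rcases h2 with (h2 | h2) | h2
      · exact h2
      · rcases h1 with h1 | h1
        exacts [absurd h2 (disjoint_left.1 hTZ h1), absurd h2 ((hWmem y).1 (hS h1)).2.2.2]
      · rcases h1 with h1 | h1
        exacts [absurd h1 ((hWmem y).1 (hS' h2)).2.2.1, absurd h2 (disjoint_left.1 hd h1)]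
    have := card_le_card hsub
    rw [card_erase_of_mem hx] at this
    omega
  have hcases : ∀ A, Movable i j (standardFamily n k T Z) A →
      (∃ S ⊆ W, #S = k - t - 1 ∧ A = insert i (T ∪ S)) ∨
      (∃ x ∈ T, ∃ S ⊆ W, #S = k + 1 - t - #Z ∧ A = T.erase x ∪ Z ∪ S) := by
    rintro A ⟨hA, hiA, hjA, hne⟩
    obtain ⟨⟨hAn, hAk⟩, hA2⟩ := mem_standardFamily.1 hA
    by_cases hTA : T ⊆ A
    · left
      have hAZ : ∀ z ∈ A, z ∈ Z → z = i := by
        intro z hz hzZ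
        by_contra hzi
        refine hne (mem_standardFamily.2 ⟨⟨exchange_subset (hZ hiZ) hj hAn,
          (card_exchange _ _ _).trans hAk⟩, Or.inl ⟨fun x hx => ?_, z, ?_⟩⟩)
        · rw [exchange_eq_insert_erase' hiA hjA]
          exact mem_insert_of_mem (mem_erase.2 ⟨fun h => hiT (h ▸ hx), hTA hx⟩)
        · rw [exchange_eq_insert_erase' hiA hjA]
          simp [hz, hzi, hzZ]
      have hsub : insert i T ⊆ A := insert_subset hiA hTA
      refine ⟨A \ insert i T, fun x hx => ?_, ?_, ?_⟩
      · rw [mem_sdiff, mem_insert, not_or] at hx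
        exact (hWmem x).2 ⟨hAn hx.1, fun h => hjA (h ▸ hx.1), hx.2.2,
          fun h => hx.2.1 (hAZ x hx.1 h)⟩
      · rw [card_sdiff_of_subset hsub, card_insert_of_notMem hiT]
        omega
      · rw [← insert_union, union_sdiff_of_subset hsub]
    · right
      have hA3 := hA2.resolve_left fun h => hTA h.1
      obtain ⟨x, hxT, hxA⟩ := not_subset.1 hTA
      have hsub : T.erase x ∪ Z ⊆ A :=
        union_subset (erase_subset_of_card_le hA3.2 hxT hxA) hA3.1
      refine ⟨x, hxT, A \ (T.erase x ∪ Z), fun y hy => ?_, ?_, ?_⟩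
      · rw [mem_sdiff, mem_union, not_or, mem_erase] at hy
        refine (hWmem y).2 ⟨hAn hy.1, fun h => hjA (h ▸ hy.1), fun h => hy.2.1 ⟨?_, h⟩, hy.2.2⟩
        rintro rfl
        exact hxA hy.1
      · rw [card_sdiff_of_subset hsub,
          card_union_of_disjoint (disjoint_of_subset_left (erase_subset _ _) hTZ),
          card_erase_of_mem hxT]
        omega
      · rw [union_sdiff_of_subset hsub]
  have hkn : ∀ x ∈ T, ∀ S ⊆ W, ∀ S' ⊆ W, #S = k - t - 1 → #S' = k + 1 - t - #Z →
      (P (insert i (T ∪ S)) ↔ P (T.erase x ∪ Z ∪ S')) := by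
    intro x hx S hS S' hS' hSc hSc'
    exact iff_of_forall_disjoint_iff (P := fun S => P (insert i (T ∪ S)))
      (Q := fun S => P (T.erase x ∪ Z ∪ S)) (W := W) (by omega)
      (fun S hS S' hS' h1 h2 hd => hP _ _ (hα S hS h1) (hβ x hx S' hS' h2)
        (hconf x hx S hS S' hS' hd)) hS hS' hSc hSc'
  obtain ⟨x₀, hx₀⟩ : T.Nonempty := card_pos.1 (by omega)
  obtain ⟨S₀, hS₀, hS₀c⟩ := exists_subset_card_eq (s := W) (n := k - t - 1) (by omega)
  obtain ⟨S₁, hS₁, hS₁c⟩ := exists_subset_card_eq (s := W) (n := k + 1 - t - #Z) (by omega)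
  have hall : ∀ A, Movable i j (standardFamily n k T Z) A → (P A ↔ P (insert i (T ∪ S₀))) := by
    intro A hA
    rcases hcases A hA with ⟨S, hS, hSc, rfl⟩ | ⟨x, hx, S, hS, hSc, rfl⟩
    · rw [hkn x₀ hx₀ S hS S₁ hS₁ hSc hS₁c, hkn x₀ hx₀ S₀ hS₀ S₁ hS₁ hS₀c hS₁c]
    · rw [hkn x hx S₀ hS₀ S hS hS₀c hSc]
  rw [hall A hA, hall B hB]

theorem Conflicting.iff_of_mem_left {n k t i j : ℕ} {T Z : Finset ℕ} {P : Finset ℕ → Prop}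
    (hT : T ⊆ Icc 1 n) (hZ : Z ⊆ Icc 1 n) (hTZ : Disjoint T Z) (hTt : #T = t)
    (hZ2 : 2 ≤ #Z) (hk : t + 2 ≤ k) (hn : 2 * k + 2 ≤ n + t)
    (hj : j ∈ Icc 1 n) (hiT : i ∈ T) (hjT : j ∉ T)
    (hP : Conflicting t i j (standardFamily n k T Z) P) {A B : Finset ℕ}
    (hA : Movable i j (standardFamily n k T Z) A)
    (hB : Movable i j (standardFamily n k T Z) B) : P A ↔ P B := by
  have hiZ : i ∉ Z := disjoint_left.1 hTZ hiT
  have hij : i ≠ j := fun h => hjT (h ▸ hiT)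
  have ht : 1 ≤ t := hTt ▸ card_pos.2 ⟨i, hiT⟩
  obtain ⟨W, hW⟩ : ∃ W, W = Icc 1 n \ insert j T := ⟨_, rfl⟩
  have hWmem : ∀ x, x ∈ W ↔ x ∈ Icc 1 n ∧ x ≠ j ∧ x ∉ T := fun x => by
    rw [hW]
    simp only [mem_sdiff, mem_insert]
    tauto
  have hWc : #W = n - t - 1 := by
    rw [hW, card_sdiff_of_subset (insert_subset hj hT),
      card_insert_of_notMem hjT, Nat.card_Icc]
    omega
  have hZW : ∀ y ∈ Z.erase j, y ∈ W := fun y hy => by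
    rw [mem_erase] at hy
    exact (hWmem y).2 ⟨hZ hy.2, hy.1, disjoint_right.1 hTZ hy.2⟩
  have hα : ∀ R ⊆ W, #R = k - t → (∃ y ∈ Z.erase j, y ∈ R) → (∃ z ∈ Z.erase j, z ∉ R) →
      Movable i j (standardFamily n k T Z) (T ∪ R) := by
    rintro R hR hRc ⟨y, hy, hyR⟩ ⟨z, hz, hzR⟩
    have hSW := fun x hx => (hWmem x).1 (hR hx)
    have hd : Disjoint T R := disjoint_right.2 fun x hx => (hSW x hx).2.2
    have hjA : j ∉ T ∪ R := by
      rw [mem_union]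
      rintro (h | h)
      exacts [hjT h, (hSW j h).2.1 rfl]
    have hiA : i ∈ T ∪ R := mem_union_left _ hiT
    refine ⟨mem_standardFamily.2 ⟨⟨?_, ?_⟩, Or.inl ⟨subset_union_left, y, ?_⟩⟩, hiA, hjA, ?_⟩
    · exact union_subset hT fun x hx => (hSW x hx).1
    · rw [card_union_of_disjoint hd]
      omega
    · rw [mem_inter]
      exact ⟨mem_union_right _ hyR, mem_of_mem_erase hy⟩
    · rw [exchange_eq_insert_erase' hiA hjA, mem_standardFamily]
      rintro ⟨-, ⟨h, -⟩ | ⟨h, -⟩⟩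
      · have := h hiT
        rw [mem_insert] at this
        exact this.elim hij (notMem_erase _ _)
      · have := h (mem_of_mem_erase hz)
        rw [mem_insert, mem_erase, mem_union] at this
        rcases this with h | ⟨-, h | h⟩
        exacts [(mem_erase.1 hz).1 h, disjoint_right.1 hTZ (mem_of_mem_erase hz) h, hzR h]
  have hconf : ∀ R ⊆ W, ∀ R' ⊆ W, Disjoint R R' → #((T ∪ R) ∩ exchange i j (T ∪ R')) < t := by
    intro R hR R' hR' hd
    have hsub : (T ∪ R) ∩ exchange i j (T ∪ R') ⊆ T.erase i := by
      intro y hy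
      rw [mem_inter, mem_exchange] at hy
      obtain ⟨h1, h2⟩ := hy
      have h3 : y ≠ i := by
        rintro rfl
        rw [if_pos rfl, mem_union] at h2
        rcases h2 with h | h
        exacts [hjT h, ((hWmem j).1 (hR' h)).2.1 rfl]
      have h4 : y ≠ j := by
        rintro rfl
        rcases mem_union.1 h1 with h | h
        exacts [hjT h, ((hWmem y).1 (hR h)).2.1 rfl]
      rw [if_neg h3, if_neg h4] at h2
      rw [mem_union] at h1 h2
      rw [mem_erase]
      refine ⟨h3, ?_⟩
      rcases h1 with h1 | h1
      · exact h1
      · exact h2.resolve_right (disjoint_left.1 hd h1)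
    have := card_le_card hsub
    rw [card_erase_of_mem hiT] at this
    omega
  have fact1 : ∀ y ∈ Z.erase j, ∀ z ∈ Z.erase j, y ≠ z → ∀ R ⊆ W, ∀ R' ⊆ W, #R = k - t →
      #R' = k - t → y ∈ R → z ∉ R → z ∈ R' → y ∉ R' → (P (T ∪ R) ↔ P (T ∪ R')) := by
    intro y hy z hz hyz R hR R' hR' hRc hRc' hyR hzR hzR' hyR'
    have hWyz : #((W.erase y).erase z) = #W - 2 := by
      rw [card_erase_of_mem (mem_erase.2 ⟨hyz.symm, hZW z hz⟩), card_erase_of_mem (hZW y hy)]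
      omega
    have hsub : ∀ S ⊆ (W.erase y).erase z, S ⊆ W ∧ y ∉ S ∧ z ∉ S := fun S hS =>
      ⟨(hS.trans (erase_subset _ _)).trans (erase_subset _ _),
        fun h => by simpa using hS h, fun h => by simpa using hS h⟩
    have := iff_of_forall_disjoint_iff (W := (W.erase y).erase z) (p := k - t - 1) (q := k - t - 1)
      (P := fun S => P (T ∪ insert y S)) (Q := fun S => P (T ∪ insert z S)) (by omega)
      (fun S hS S' hS' h1 h2 hd => by
        obtain ⟨hS1, hS2, hS3⟩ := hsub S hS
        obtain ⟨hS1', hS2', hS3'⟩ := hsub S' hS'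
        have e1 : insert y S ⊆ W := insert_subset (hZW y hy) hS1
        have e2 : insert z S' ⊆ W := insert_subset (hZW z hz) hS1'
        refine hP _ _ (hα _ e1 (by rw [card_insert_of_notMem hS2]; omega)
          ⟨y, hy, mem_insert_self _ _⟩ ⟨z, hz, by simp [hyz.symm, hS3]⟩)
          (hα _ e2 (by rw [card_insert_of_notMem hS3']; omega)
          ⟨z, hz, mem_insert_self _ _⟩ ⟨y, hy, by simp [hyz, hS2']⟩) (hconf _ e1 _ e2 ?_)
        rw [disjoint_insert_left, disjoint_insert_right, mem_insert, not_or]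
        exact ⟨⟨hyz, hS2'⟩, hS3, hd⟩)
      (S := R.erase y) (S' := R'.erase z)
      (fun x hx => mem_erase.2 ⟨fun h => hzR (h ▸ mem_of_mem_erase hx),
        erase_subset_erase _ hR hx⟩)
      (fun x hx => mem_erase.2 ⟨ne_of_mem_erase hx, mem_erase.2 ⟨fun h =>
        hyR' (h ▸ mem_of_mem_erase hx), hR' (mem_of_mem_erase hx)⟩⟩)
      (by rw [card_erase_of_mem hyR, hRc]) (by rw [card_erase_of_mem hzR', hRc'])
    simpa only [insert_erase hyR, insert_erase hzR'] using this
  have hex : ∀ y ∈ W, ∀ u v, u ≠ y → v ≠ y → ∃ R ⊆ W, #R = k - t ∧ y ∈ R ∧ u ∉ R ∧ v ∉ R := by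
    intro y hy u v hu hv
    have h1 : k - t - 1 ≤ #(((W.erase y).erase u).erase v) := by
      have := pred_card_le_card_erase (s := (W.erase y).erase u) (a := v)
      have := pred_card_le_card_erase (s := W.erase y) (a := u)
      have := pred_card_le_card_erase (s := W) (a := y)
      omega
    obtain ⟨S, hS, hSc⟩ := exists_subset_card_eq h1
    refine ⟨insert y S, insert_subset hy (hS.trans ((erase_subset _ _).trans
      ((erase_subset _ _).trans (erase_subset _ _)))), ?_, mem_insert_self _ _, ?_, ?_⟩
    · rw [card_insert_of_notMem fun h => by simpa using hS h]
      omega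
    · rw [mem_insert, not_or]
      exact ⟨hu, fun h => by simpa using hS h⟩
    · rw [mem_insert, not_or]
      exact ⟨hv, fun h => by simpa using hS h⟩
  have hαα : ∀ y ∈ Z.erase j, ∀ z ∈ Z.erase j, ∀ y' ∈ Z.erase j, ∀ z' ∈ Z.erase j,
      ∀ R ⊆ W, ∀ R' ⊆ W, #R = k - t → #R' = k - t → y ∈ R → z ∉ R → y' ∈ R' → z' ∉ R' →
      (P (T ∪ R) ↔ P (T ∪ R')) := by
    intro y hy z hz y' hy' z' hz' R hR R' hR' hRc hRc' hyR hzR hyR' hzR'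
    have hyz : y ≠ z := fun h => hzR (h ▸ hyR)
    have hyz' : y' ≠ z' := fun h => hzR' (h ▸ hyR')
    have fact2 : ∀ R₂ ⊆ W, #R₂ = k - t → y ∈ R₂ → z ∉ R₂ → (P (T ∪ R) ↔ P (T ∪ R₂)) := by
      intro R₂ hR₂ hc₂ h1 h2
      obtain ⟨R₃, hR₃, hc₃, h3, h4, -⟩ := hex z (hZW z hz) y y hyz hyz
      rw [fact1 y hy z hz hyz R hR R₃ hR₃ hRc hc₃ hyR hzR h3 h4,
        fact1 y hy z hz hyz R₂ hR₂ R₃ hR₃ hc₂ hc₃ h1 h2 h3 h4]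
    by_cases hyz2 : z' = y
    · subst hyz2
      obtain ⟨R₂, hR₂, hc₂, h1, h2, h3⟩ := hex z' (hZW z' hy) z y' hyz.symm hyz'
      rw [fact2 R₂ hR₂ hc₂ h1 h2]
      exact fact1 z' hy y' hy' hyz'.symm R₂ hR₂ R' hR' hc₂ hRc' h1 h3 hyR' hzR'
    · obtain ⟨R₂, hR₂, hc₂, h1, h2, h3⟩ := hex y (hZW y hy) z z' hyz.symm hyz2
      obtain ⟨R₃, hR₃, hc₃, h4, h5, h6⟩ := hex z' (hZW z' hz') y y' (Ne.symm hyz2) hyz'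
      rw [fact2 R₂ hR₂ hc₂ h1 h2, fact1 y hy z' hz' (Ne.symm hyz2) R₂ hR₂ R₃ hR₃ hc₂ hc₃ h1 h3 h4 h5]
      exact fact1 z' hz' y' hy' hyz'.symm R₃ hR₃ R' hR' hc₃ hRc' h4 h6 hyR' hzR'
  have hred : ∀ A, Movable i j (standardFamily n k T Z) A → ∃ y ∈ Z.erase j, ∃ z ∈ Z.erase j,
      ∃ R ⊆ W, #R = k - t ∧ y ∈ R ∧ z ∉ R ∧ (P A ↔ P (T ∪ R)) := by
    intro A hmov
    obtain ⟨hA, hiA, hjA, hne⟩ := id hmov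
    obtain ⟨⟨hAn, hAk⟩, hA2⟩ := mem_standardFamily.1 hA
    by_cases hTA : T ⊆ A
    · obtain ⟨y, hy⟩ : (A ∩ Z).Nonempty := by
        rcases hA2 with h | h
        · exact h.2
        · rw [inter_eq_right.2 h.1]
          exact card_pos.1 (by omega)
      rw [mem_inter] at hy
      obtain ⟨z, hz, hzA⟩ : ∃ z ∈ Z.erase j, z ∉ A := by
        by_contra hc
        push Not at hc
        refine hne (mem_standardFamily.2 ⟨⟨exchange_subset (hT hiT) hj hAn,
          (card_exchange _ _ _).trans hAk⟩, Or.inr ⟨fun x hx => ?_, ?_⟩⟩)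
        · rw [exchange_eq_insert_erase' hiA hjA, mem_insert, mem_erase]
          by_cases hxj : x = j
          · exact Or.inl hxj
          · exact Or.inr ⟨fun h => hiZ (h ▸ hx), hc x (mem_erase.2 ⟨hxj, hx⟩)⟩
        · have : T.erase i ⊆ exchange i j A ∩ T := by
            rw [exchange_eq_insert_erase' hiA hjA]
            exact subset_inter ((erase_subset_erase _ hTA).trans (subset_insert _ _))
              (erase_subset _ _)
          have := card_le_card this
          rw [card_erase_of_mem hiT] at this
          omega
      refine ⟨y, mem_erase.2 ⟨fun h => hjA (h ▸ hy.1), hy.2⟩, z, hz, A \ T, fun x hx => ?_, ?_,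
        ?_, fun h => hzA (mem_sdiff.1 h).1, ?_⟩
      · rw [mem_sdiff] at hx
        exact (hWmem x).2 ⟨hAn hx.1, fun h => hjA (h ▸ hx.1), hx.2⟩
      · rw [card_sdiff_of_subset hTA, hAk, hTt]
      · exact mem_sdiff.2 ⟨hy.1, disjoint_right.1 hTZ hy.2⟩
      · rw [union_sdiff_of_subset hTA]
    · have hA3 := hA2.resolve_left fun h => hTA h.1
      obtain ⟨x, hxT, hxA⟩ := not_subset.1 hTA
      have hxi : x ≠ i := fun h => hxA (h ▸ hiA)
      have hTx := erase_subset_of_card_le hA3.2 hxT hxA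
      have hjZ : j ∉ Z := fun h => hjA (hA3.1 h)
      obtain ⟨y, hy, z, hz, hyz⟩ := one_lt_card.1 hZ2
      have hc : k - t - 1 ≤ #(W \ A) := by
        have h1 : W ∩ A ⊆ A \ T.erase x := fun v hv => by
          rw [mem_inter, hWmem] at hv
          exact mem_sdiff.2 ⟨hv.2, fun h => hv.1.2.2 (mem_of_mem_erase h)⟩
        have h2 := card_le_card h1
        rw [card_sdiff_of_subset hTx, card_erase_of_mem hxT] at h2
        have := card_sdiff_add_card_inter W A
        omega
      obtain ⟨S, hS, hSc⟩ := exists_subset_card_eq hc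
      have hSA : ∀ v ∈ S, v ∉ A := fun v hv => (mem_sdiff.1 (hS hv)).2
      have hy' : y ∈ Z.erase j := mem_erase.2 ⟨fun h => hjZ (h ▸ hy), hy⟩
      have hz' : z ∈ Z.erase j := mem_erase.2 ⟨fun h => hjZ (h ▸ hz), hz⟩
      have hRW : insert y S ⊆ W := insert_subset (hZW y hy') (hS.trans sdiff_subset)
      have hRc : #(insert y S) = k - t := by
        rw [card_insert_of_notMem fun h => hSA y h (hA3.1 hy)]
        omega
      have hzR : z ∉ insert y S := by
        rw [mem_insert, not_or]
        exact ⟨hyz.symm, fun h => hSA z h (hA3.1 hz)⟩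
      refine ⟨y, hy', z, hz', insert y S, hRW, hRc, mem_insert_self _ _, hzR,
        hP _ _ hmov (hα _ hRW hRc ⟨y, hy', mem_insert_self _ _⟩ ⟨z, hz', hzR⟩) ?_⟩
      have hsub : A ∩ exchange i j (T ∪ insert y S) ⊆ insert y ((T.erase x).erase i) := by
        intro v hv
        rw [mem_inter, mem_exchange] at hv
        obtain ⟨h1, h2⟩ := hv
        have h3 : v ≠ i := by
          rintro rfl
          rw [if_pos rfl, mem_union] at h2
          rcases h2 with h | h
          exacts [hjT h, ((hWmem j).1 (hRW h)).2.1 rfl]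
        have h4 : v ≠ j := fun h => hjA (h ▸ h1)
        rw [if_neg h3, if_neg h4, mem_union, mem_insert] at h2
        rw [mem_insert, mem_erase, mem_erase]
        rcases h2 with h | h | h
        · exact Or.inr ⟨h3, fun h5 => hxA (h5 ▸ h1), h⟩
        · exact Or.inl h
        · exact absurd h1 (hSA v h)
      have h5 := card_le_card hsub
      have h6 := card_insert_le y ((T.erase x).erase i)
      have h7 : 1 < #T := one_lt_card.2 ⟨x, hxT, i, hiT, hxi⟩
      rw [card_erase_of_mem (mem_erase.2 ⟨hxi.symm, hiT⟩), card_erase_of_mem hxT] at h6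
      omega
  obtain ⟨y, hy, z, hz, R, hR, hRc, h1, h2, h3⟩ := hred A hA
  obtain ⟨y', hy', z', hz', R', hR', hRc', h1', h2', h3'⟩ := hred B hB
  rw [h3, h3', hαα y hy z hz y' hy' z' hz' R hR R' hR' hRc hRc' h1 h2 h1' h2']

/-- Undoing a compression that yields a standard family yields a standard family. -/
theorem exists_eq_standardFamily_of_shift_eq {n k t i j : ℕ} {T Z : Finset ℕ}
    {𝓖 : Finset (Finset ℕ)}
    (hT : T ⊆ Icc 1 n) (hZ : Z ⊆ Icc 1 n) (hTZ : Disjoint T Z) (hTt : #T = t) (ht : 1 ≤ t)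
    (hZ2 : 2 ≤ #Z) (hZk : t + #Z ≤ k + 1) (hk : t + 2 ≤ k) (hn : 2 * k + 2 ≤ n + t)
    (hi : i ∈ Icc 1 n) (hj : j ∈ Icc 1 n) (h𝓖 : ∀ A ∈ 𝓖, ∀ B ∈ 𝓖, t ≤ #(A ∩ B))
    (h : shift i j 𝓖 = standardFamily n k T Z) :
    ∃ T' Z' : Finset ℕ, T' ⊆ Icc 1 n ∧ Z' ⊆ Icc 1 n ∧ Disjoint T' Z' ∧ #T' = t ∧ #Z' = #Z ∧
      𝓖 = standardFamily n k T' Z' := by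
  have hiff : ∀ A, Movable i j (standardFamily n k T Z) A → (A ∈ 𝓖 ↔ exchange i j A ∉ 𝓖) := by
    rintro A ⟨hA, hiA, hjA, hne⟩
    rw [← h, mem_shift] at hA hne
    rw [exchange_exchange] at hne
    have : j ∈ exchange i j A := by
      rw [exchange_eq_insert_erase' hiA hjA]
      exact mem_insert_self _ _
    tauto
  have hP : Conflicting t i j (standardFamily n k T Z) (· ∈ 𝓖) := by
    intro A B hA hB hAB
    have hAB' := hAB
    rw [← card_exchange_inter] at hAB'
    change A ∈ 𝓖 ↔ B ∈ 𝓖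
    constructor
    · intro hA'
      rw [hiff B hB]
      exact fun hB' => (h𝓖 _ hA' _ hB').not_gt hAB
    · intro hB'
      rw [hiff A hA]
      exact fun hA' => (h𝓖 _ hA' _ hB').not_gt hAB'
  have hK : ∀ A B, Movable i j (standardFamily n k T Z) A →
      Movable i j (standardFamily n k T Z) B → (A ∈ 𝓖 ↔ B ∈ 𝓖) := by
    intro A B hA hB
    by_cases h1 : i ∈ Z ∧ j ∉ T ∧ j ∉ Z
    · exact hP.iff_of_mem_right hT hZ hTZ hTt ht hZk hk hn hj h1.1 h1.2.1 h1.2.2 hA hB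
    · by_cases h2 : i ∈ T ∧ j ∉ T
      · exact hP.iff_of_mem_left hT hZ hTZ hTt hZ2 hk hn hj h2.1 h2.2 hA hB
      · exact absurd hA (not_movable hTZ hZ2 hi hj h1 h2 A)
  rcases eq_or_eq_image_exchange_of_shift_eq h fun A a1 a2 a3 a4 B b1 b2 b3 b4 =>
    (hK A B ⟨a1, a2, a3, a4⟩ ⟨b1, b2, b3, b4⟩).1 with h1 | h1
  · exact ⟨T, Z, hT, hZ, hTZ, hTt, rfl, h1⟩
  · refine ⟨exchange i j T, exchange i j Z, exchange_subset hi hj hT, exchange_subset hi hj hZ,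
      (disjoint_image (Equiv.injective _)).2 hTZ, (card_exchange _ _ _).trans hTt,
      card_exchange _ _ _, h1.trans (permute_standardFamily fun x hx => ?_)⟩
    exact Equiv.swap_apply_of_ne_of_ne (fun h => hx (h ▸ hi)) (fun h => hx (h ▸ hj))

/-- `𝓕` is closed under replacing elements of `[n]` by smaller ones. -/
def IsShifted (n : ℕ) (𝓕 : Finset (Finset ℕ)) : Prop :=
  ∀ a b, 1 ≤ a → a < b → b ≤ n → ∀ A ∈ 𝓕, b ∈ A → a ∉ A → insert a (A.erase b) ∈ 𝓕

/-- Membership in `𝓕` is inherited by all `k`-sets containing the trace on `[s]` of a member. -/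
def IsGenerated (n k s : ℕ) (𝓕 : Finset (Finset ℕ)) : Prop :=
  ∀ A ∈ 𝓕, ∀ B ⊆ Icc 1 n, #B = k → A ∩ Icc 1 s ⊆ B → B ∈ 𝓕

theorem IsLargest.eq_of_subset {n k t : ℕ} {𝓕 𝓖 : Finset (Finset ℕ)} (h : IsLargest n k t 𝓕)
    (h𝓖 : NontrivialIntersecting n k t 𝓖) (hsub : 𝓕 ⊆ 𝓖) : 𝓕 = 𝓖 :=
  eq_of_subset_of_card_le hsub (h.2 𝓖 h𝓖)

theorem le_card_trace_inter {n k t s : ℕ} {𝓕 : Finset (Finset ℕ)}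
    (h : NontrivialIntersecting n k t 𝓕) (hs : IsShifted n 𝓕) (hg : IsGenerated n k s 𝓕)
    (hn : 2 * k + 2 ≤ n + t) {A B : Finset ℕ} (hA : A ∈ 𝓕) (hB : B ∈ 𝓕) :
    t ≤ #(A ∩ B ∩ Icc 1 s) := by
  induction hm : #((A ∩ B) \ Icc 1 s) generalizing A with
  | zero =>
    rw [card_eq_zero, sdiff_eq_empty_iff_subset] at hm
    rw [inter_eq_left.2 hm]
    exact h.le_card_inter A hA B hB
  | succ m ih =>
    obtain ⟨x, hx⟩ : ((A ∩ B) \ Icc 1 s).Nonempty := card_pos.1 (by omega)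
    have hx' := hx
    rw [mem_sdiff, mem_inter] at hx
    obtain ⟨⟨hxA, hxB⟩, hxs⟩ := hx
    have hxn := mem_Icc.1 (h.subset A hA hxA)
    have hxs' : s < x := by
      rw [mem_Icc] at hxs
      omega
    obtain ⟨y, hy, hyAB⟩ : ∃ y ∈ Icc 1 n, y ∉ A ∪ B := by
      by_contra hc
      push Not at hc
      have h1 := card_le_card (show Icc 1 n ⊆ A ∪ B from hc)
      have h2 := card_union_add_card_inter A B
      have h3 := h.le_card_inter A hA B hB
      rw [h.card_eq A hA, h.card_eq B hB] at h2
      rw [Nat.card_Icc] at h1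
      omega
    rw [mem_union, not_or] at hyAB
    obtain ⟨hyA, hyB⟩ := hyAB
    have hyx : y ≠ x := fun h => hyA (h ▸ hxA)
    have hmem : insert y (A.erase x) ∈ 𝓕 := by
      by_cases hys : y ≤ s
      · exact hs y x (mem_Icc.1 hy).1 (by omega) hxn.2 A hA hxA hyA
      · refine hg A hA _ (insert_subset hy ((erase_subset _ _).trans (h.subset A hA))) ?_ ?_
        · rw [card_insert_of_notMem fun h => hyA (mem_of_mem_erase h), card_erase_of_mem hxA,
            h.card_eq A hA]
          have := card_pos.2 ⟨x, hxA⟩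
          rw [h.card_eq A hA] at this
          omega
        · intro z hz
          rw [mem_inter] at hz
          exact mem_insert_of_mem (mem_erase.2 ⟨fun h => hxs (h ▸ hz.2), hz.1⟩)
    have e1 : insert y (A.erase x) ∩ B = (A ∩ B).erase x := by
      rw [insert_inter_of_notMem hyB, erase_inter]
    have := ih hmem (by
      rw [e1, erase_sdiff_comm, card_erase_of_mem hx', hm]
      rfl)
    rwa [e1, erase_inter, erase_eq_of_notMem fun h => hxs (mem_inter.1 h).2] at this

theorem lt_card_trace {n k t s : ℕ} {𝓕 : Finset (Finset ℕ)}
    (h : NontrivialIntersecting n k t 𝓕) (hs : IsShifted n 𝓕) (hg : IsGenerated n k s 𝓕)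
    (hn : 2 * k + 2 ≤ n + t) {A : Finset ℕ} (hA : A ∈ 𝓕) : t + 1 ≤ #(A ∩ Icc 1 s) := by
  by_contra hc
  have h1 := le_card_trace_inter h hs hg hn hA hA
  rw [inter_self] at h1
  refine (h.card_lt (A ∩ Icc 1 s) fun B hB => ?_).not_ge h1
  have h2 := le_card_trace_inter h hs hg hn hA hB
  rw [inter_right_comm] at h2
  exact inter_eq_left.1 (eq_of_subset_of_card_le inter_subset_left (by omega))

theorem IsGenerated.mono {n k s s' : ℕ} {𝓕 : Finset (Finset ℕ)} (h : IsGenerated n k s 𝓕)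
    (hs : s ≤ s') : IsGenerated n k s' 𝓕 := fun A hA B hB hBk hAB =>
  h A hA B hB hBk ((inter_subset_inter_left (Icc_subset_Icc_right hs)).trans hAB)

theorem NontrivialIntersecting.isGenerated {n k t : ℕ} {𝓕 : Finset (Finset ℕ)}
    (h : NontrivialIntersecting n k t 𝓕) : IsGenerated n k n 𝓕 := by
  intro A hA B hB hBk hAB
  rw [inter_eq_left.2 (h.subset A hA)] at hAB
  rwa [← eq_of_subset_of_card_le hAB (by rw [hBk, h.card_eq A hA])]

/-- A property closed under lowering elements passes from a set to an initial interval. -/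
theorem of_forall_insert_erase {lo : ℕ} {Q : Finset ℕ → Prop}
    (hQ : ∀ D, Q D → ∀ a b, lo ≤ a → a < b → b ∈ D → a ∉ D → Q (insert a (D.erase b)))
    {D : Finset ℕ} (hD : Q D) (hlo : ∀ x ∈ D, lo ≤ x) : Q (Ico lo (lo + #D)) := by
  induction hm : ∑ x ∈ D, x using Nat.strong_induction_on generalizing D with
  | _ m ih =>
    by_cases hsub : Ico lo (lo + #D) ⊆ D
    · rwa [eq_of_subset_of_card_le hsub (by simp)]
    · obtain ⟨a, ha, haD⟩ := not_subset.1 hsub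
      obtain ⟨b, hb, hbI⟩ : ∃ b ∈ D, b ∉ Ico lo (lo + #D) := by
        by_contra hc
        push Not at hc
        exact hsub (eq_of_subset_of_card_le (show D ⊆ _ from hc) (by simp)).ge
      have hblo := hlo b hb
      rw [mem_Ico] at ha hbI
      have hab : a < b := by omega
      have hac : a ∉ D.erase b := fun h => haD (mem_of_mem_erase h)
      have hcard : #(insert a (D.erase b)) = #D := by
        have := card_pos.2 ⟨b, hb⟩
        rw [card_insert_of_notMem hac, card_erase_of_mem hb]
        omega
      rw [← hcard]
      refine ih _ ?_ (hQ D hD a b ha.1 hab hb haD) ?_ rfl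
      · rw [← hm, sum_insert hac, ← add_sum_erase D _ hb]
        omega
      · intro x hx
        rw [mem_insert] at hx
        rcases hx with rfl | hx
        exacts [ha.1, hlo x (mem_of_mem_erase hx)]

open Classical in
/-- Traces `E ∋ s` of size `i` on `[s]` of members of `𝓕`, such that not all `k`-sets with
trace `E \ {s}` belong to `𝓕`. -/
noncomputable def criticalTraces (n k s : ℕ) (𝓕 : Finset (Finset ℕ)) (i : ℕ) :
    Finset (Finset ℕ) :=
  {E ∈ (Icc 1 s).powersetCard i | s ∈ E ∧ (∃ A ∈ 𝓕, A ∩ Icc 1 s = E) ∧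
    ∃ B ⊆ Icc 1 n, #B = k ∧ B ∩ Icc 1 s = E.erase s ∧ B ∉ 𝓕}

theorem mem_criticalTraces {n k s i : ℕ} {𝓕 : Finset (Finset ℕ)} {E : Finset ℕ} :
    E ∈ criticalTraces n k s 𝓕 i ↔ (E ⊆ Icc 1 s ∧ #E = i) ∧ s ∈ E ∧
      (∃ A ∈ 𝓕, A ∩ Icc 1 s = E) ∧
      ∃ B ⊆ Icc 1 n, #B = k ∧ B ∩ Icc 1 s = E.erase s ∧ B ∉ 𝓕 := by
  unfold criticalTraces
  simp only [mem_filter, mem_powersetCard]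

section

variable {n k t s i j : ℕ} {𝓕 : Finset (Finset ℕ)} {E : Finset ℕ}

/-- The hypotheses shared by the analysis of shifted families with generating sets in `[s]`. -/
structure ShiftedGenerated (n k t s : ℕ) (𝓕 : Finset (Finset ℕ)) : Prop where
  nontrivial : NontrivialIntersecting n k t 𝓕
  shifted : IsShifted n 𝓕
  generated : IsGenerated n k s 𝓕
  le_n : s ≤ n
  ground : 2 * k + 2 ≤ n + t

theorem ShiftedGenerated.le_card_inter (H : ShiftedGenerated n k t s 𝓕) {A B : Finset ℕ}
    (hA : A ∈ 𝓕) (hB : B ∈ 𝓕) : t ≤ #(A ∩ B ∩ Icc 1 s) :=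
  le_card_trace_inter H.nontrivial H.shifted H.generated H.ground hA hB

theorem ShiftedGenerated.mem_of_subset (H : ShiftedGenerated n k t s 𝓕)
    (hE : E ∈ criticalTraces n k s 𝓕 i) {B : Finset ℕ} (hB : B ⊆ Icc 1 n) (hBk : #B = k)
    (hEB : E ⊆ B) : B ∈ 𝓕 := by
  obtain ⟨-, -, ⟨A, hA, rfl⟩, -⟩ := mem_criticalTraces.1 hE
  exact H.generated A hA B hB hBk hEB

theorem ShiftedGenerated.lt_card (H : ShiftedGenerated n k t s 𝓕)
    (hE : E ∈ criticalTraces n k s 𝓕 i) : t + 1 ≤ i := by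
  obtain ⟨⟨-, hi⟩, -, ⟨A, hA, rfl⟩, -⟩ := mem_criticalTraces.1 hE
  rw [← hi]
  exact lt_card_trace H.nontrivial H.shifted H.generated H.ground hA

theorem ShiftedGenerated.card_le (H : ShiftedGenerated n k t s 𝓕)
    (hE : E ∈ criticalTraces n k s 𝓕 i) : i ≤ k := by
  obtain ⟨⟨-, hi⟩, -, ⟨A, hA, rfl⟩, -⟩ := mem_criticalTraces.1 hE
  rw [← hi, ← H.nontrivial.card_eq A hA]
  exact card_le_card inter_subset_left

theorem card_le_of_mem_criticalTraces (hE : E ∈ criticalTraces n k s 𝓕 i) : i ≤ s := by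
  obtain ⟨⟨h, hi⟩, -⟩ := mem_criticalTraces.1 hE
  simpa [hi] using card_le_card h

theorem ShiftedGenerated.lt_sub (H : ShiftedGenerated n k t s 𝓕)
    (hE : E ∈ criticalTraces n k s 𝓕 i) : k + 1 + s ≤ n + i := by
  obtain ⟨⟨-, hi⟩, hsE, -, B, hB, hBk, hBE, -⟩ := mem_criticalTraces.1 hE
  have h1 := card_sdiff_add_card_inter B (Icc 1 s)
  rw [hBE, card_erase_of_mem hsE, hi, hBk] at h1
  have h2 : B \ Icc 1 s ⊆ Icc 1 n \ Icc 1 s := sdiff_subset_sdiff hB subset_rfl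
  have h3 := card_le_card h2
  rw [card_sdiff_of_subset (Icc_subset_Icc_right H.le_n), Nat.card_Icc, Nat.card_Icc] at h3
  have := card_pos.2 ⟨s, hsE⟩
  have := H.le_n
  omega

/-- No member has the trace `E \ {s}`. -/
theorem ShiftedGenerated.trace_ne (H : ShiftedGenerated n k t s 𝓕)
    (hE : E ∈ criticalTraces n k s 𝓕 i) {B : Finset ℕ} (hB : B ∈ 𝓕) :
    B ∩ Icc 1 s ≠ E.erase s := by
  obtain ⟨-, -, -, C, hC, hCk, hCE, hCF⟩ := mem_criticalTraces.1 hE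
  intro h
  exact hCF (H.generated B hB C hC hCk (h.trans hCE.symm ▸ inter_subset_left))

theorem ShiftedGenerated.exists_mem_criticalTraces (H : ShiftedGenerated n k t s 𝓕)
    (hs : 1 ≤ s) (hng : ¬ IsGenerated n k (s - 1) 𝓕) :
    ∃ i E, E ∈ criticalTraces n k s 𝓕 i := by
  simp only [IsGenerated, not_forall] at hng
  obtain ⟨A, hA, B, hB, hBk, hAB, hBF⟩ := hng
  have htr : ∀ x ∈ A ∩ Icc 1 s, x = s ∨ x ∈ B := by
    intro x hx
    rw [mem_inter, mem_Icc] at hx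
    by_cases hxs : x = s
    · exact Or.inl hxs
    · exact Or.inr (hAB (mem_inter.2 ⟨hx.1, mem_Icc.2 ⟨hx.2.1, by omega⟩⟩))
  have hsA : s ∈ A := by
    by_contra hsA
    exact hBF (H.generated A hA B hB hBk fun x hx =>
      (htr x hx).resolve_left fun h => hsA (h ▸ (mem_inter.1 hx).1))
  have hsB : s ∉ B := fun hsB =>
    hBF (H.generated A hA B hB hBk fun x hx => (htr x hx).elim (fun h => h ▸ hsB) id)
  have hswap : ∀ y ∈ B, y ∉ A ∨ s < y → insert s (B.erase y) ∈ 𝓕 := by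
    intro y hy hyA
    refine H.generated A hA _ (insert_subset (mem_Icc.2 ⟨hs, H.le_n⟩)
      ((erase_subset _ _).trans hB)) ?_ fun x hx => ?_
    · rw [card_insert_of_notMem fun h => hsB (mem_of_mem_erase h), card_erase_of_mem hy]
      have := card_pos.2 ⟨y, hy⟩
      omega
    · rw [mem_insert, mem_erase]
      refine (htr x hx).imp id fun h => ⟨?_, h⟩
      rw [mem_inter, mem_Icc] at hx
      rintro rfl
      rcases hyA with h | h
      · exact h hx.1
      · omega
  obtain ⟨x, hxB, hxs⟩ : ∃ x ∈ B, s < x := by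
    by_contra hc
    push Not at hc
    obtain ⟨y, hyB, hyA⟩ : ∃ y ∈ B, y ∉ A := by
      by_contra hc'
      push Not at hc'
      refine hsB ?_
      rw [eq_of_subset_of_card_le (show B ⊆ A from hc') (by rw [hBk, H.nontrivial.card_eq A hA])]
      exact hsA
    have h1 := hswap y hyB (Or.inl hyA)
    have hys : y < s := lt_of_le_of_ne (hc y hyB) fun h => hsB (h ▸ hyB)
    have h2 := H.shifted y s (mem_Icc.1 (hB hyB)).1 hys H.le_n _ h1 (mem_insert_self _ _)
      (by simp [hys.ne])
    rw [erase_insert fun h => hsB (mem_of_mem_erase h), insert_erase hyB] at h2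
    exact hBF h2
  have h1 := hswap x hxB (Or.inr hxs)
  have hsI : s ∈ Icc 1 s := mem_Icc.2 ⟨hs, le_rfl⟩
  refine ⟨_, insert s (B.erase x) ∩ Icc 1 s, mem_criticalTraces.2 ⟨⟨inter_subset_right, rfl⟩,
    mem_inter.2 ⟨mem_insert_self _ _, hsI⟩, ⟨_, h1, rfl⟩, B, hB, hBk, ?_, hBF⟩⟩
  rw [← erase_inter, erase_insert fun h => hsB (mem_of_mem_erase h), erase_inter,
    erase_eq_of_notMem]
  simp only [mem_inter, mem_Icc]
  omega

theorem ShiftedGenerated.lt_card_inter (H : ShiftedGenerated n k t s 𝓕)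
    (hE : E ∈ criticalTraces n k s 𝓕 i) {A : Finset ℕ} (hA : A ∈ 𝓕) (hsA : s ∈ A)
    (hne : #(A ∩ Icc 1 s) + i ≠ s + t) : t + 1 ≤ #(E ∩ A) := by
  obtain ⟨⟨hEs, hi⟩, hsE, ⟨C, hC, hCE⟩, -⟩ := mem_criticalTraces.1 hE
  have h1 : ∀ B ∈ 𝓕, t ≤ #(E ∩ B) := fun B hB => by
    have := H.le_card_inter hC hB
    rwa [inter_right_comm, hCE] at this
  have h0 := h1 A hA
  by_contra hc
  have hcov : Icc 1 s ⊆ E ∪ A := by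
    intro y hy
    by_contra hyn
    rw [mem_union, not_or] at hyn
    have hys : y ≠ s := fun h => hyn.2 (h ▸ hsA)
    have h2 := H.shifted y s (mem_Icc.1 hy).1 (lt_of_le_of_ne (mem_Icc.1 hy).2 hys) H.le_n A hA
      hsA hyn.2
    have h3 := h1 _ h2
    rw [inter_insert_of_notMem hyn.1, inter_erase, card_erase_of_mem
      (mem_inter.2 ⟨hsE, hsA⟩)] at h3
    have := card_pos.2 ⟨s, mem_inter.2 ⟨hsE, hsA⟩⟩
    omega
  have h2 : E ∪ A ∩ Icc 1 s = Icc 1 s := by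
    refine subset_antisymm (union_subset hEs inter_subset_right) fun y hy => ?_
    have := hcov hy
    rw [mem_union] at this ⊢
    exact this.imp id fun h => mem_inter.2 ⟨h, hy⟩
  have h3 := card_union_add_card_inter E (A ∩ Icc 1 s)
  have h4 : E ∩ (A ∩ Icc 1 s) = E ∩ A := by
    rw [← inter_assoc, inter_eq_left]
    exact inter_subset_left.trans hEs
  rw [h2, h4, Nat.card_Icc, hi] at h3
  omega

/-- Removing all members with a given critical trace size keeps the family nontrivial. -/
theorem ShiftedGenerated.card_lt_of_forall (H : ShiftedGenerated n k t s 𝓕) (hj : j + 2 ≤ s)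
    {T : Finset ℕ} (hT : ∀ A ∈ 𝓕, ¬ (s ∈ A ∧ #(A ∩ Icc 1 s) = j) → T ⊆ A) : #T < t := by
  refine H.nontrivial.card_lt T fun A hA => ?_
  by_contra hTA
  have hA' : s ∈ A ∧ #(A ∩ Icc 1 s) = j := by
    by_contra hc
    exact hTA (hT A hA hc)
  obtain ⟨x, hxT, hxA⟩ := not_subset.1 hTA
  have hc : 1 < #(Icc 1 s \ A) := by
    have := card_sdiff_add_card_inter (Icc 1 s) A
    rw [inter_comm, hA'.2, Nat.card_Icc] at this
    omega
  obtain ⟨y, hy, hyx⟩ := exists_mem_ne hc x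
  rw [mem_sdiff, mem_Icc] at hy
  have hys : y ≠ s := fun h => hy.2 (h ▸ hA'.1)
  have h1 := H.shifted y s hy.1.1 (lt_of_le_of_ne hy.1.2 hys) H.le_n A hA hA'.1 hy.2
  have h2 := hT _ h1 (fun h => by simp [Ne.symm hys] at h) hxT
  rw [mem_insert, mem_erase] at h2
  rcases h2 with h | h
  exacts [hyx h.symm, hxA h.2]

end

theorem exists_inter_Icc_eq {n k s : ℕ} {D : Finset ℕ} (hs : s ≤ n) (hD : D ⊆ Icc 1 s)
    (hDk : #D ≤ k) (hk : k + s ≤ n + #D) : ∃ B ⊆ Icc 1 n, #B = k ∧ B ∩ Icc 1 s = D := by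
  obtain ⟨C, hC, hCk⟩ : ∃ C ⊆ Icc (s + 1) n, #C = k - #D :=
    exists_subset_card_eq (by rw [Nat.card_Icc]; omega)
  have hdisj : Disjoint (Icc 1 s) C := by
    rw [disjoint_left]
    intro x hx hxC
    have := mem_Icc.1 (hC hxC)
    rw [mem_Icc] at hx
    omega
  refine ⟨D ∪ C, union_subset (hD.trans (Icc_subset_Icc_right hs))
    (hC.trans (Icc_subset_Icc_left (by omega))), ?_, ?_⟩
  · rw [card_union_of_disjoint (hdisj.mono_left hD)]
    omega
  · rw [union_inter_distrib_right, inter_eq_left.2 hD, inter_comm C,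
      disjoint_iff_inter_eq_empty.1 hdisj, union_empty]

section

variable {n k t s i j : ℕ} {𝓕 𝒳 𝒴 : Finset (Finset ℕ)}

theorem ShiftedGenerated.le_card_inter_of_trace (H : ShiftedGenerated n k t s 𝓕)
    (hij : i + j = s + t) {E A B : Finset ℕ} (hE : E ∈ criticalTraces n k s 𝓕 i)
    (hB : B ∩ Icc 1 s = E.erase s) (hA : A ∈ 𝓕)
    (hAE : A ∩ Icc 1 s ∈ criticalTraces n k s 𝓕 j → t + 1 ≤ #(E ∩ (A ∩ Icc 1 s))) :
    t ≤ #(B ∩ A) := by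
  obtain ⟨⟨hEs, hi⟩, hsE, ⟨C, hC, hCE⟩, -⟩ := mem_criticalTraces.1 hE
  have hsub : (E ∩ A).erase s ⊆ B ∩ A := by
    rw [← erase_inter, ← hB]
    exact inter_subset_inter_right inter_subset_left
  refine le_trans ?_ (card_le_card hsub)
  by_cases hsA : s ∈ A
  · suffices t + 1 ≤ #(E ∩ A) by
      rw [card_erase_of_mem (mem_inter.2 ⟨hsE, hsA⟩)]
      omega
    by_cases hc : #(A ∩ Icc 1 s) + i = s + t
    · by_cases hcr : A ∩ Icc 1 s ∈ criticalTraces n k s 𝓕 j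
      · exact (hAE hcr).trans (card_le_card (inter_subset_inter_left inter_subset_left))
      · have hsI : s ∈ A ∩ Icc 1 s := mem_inter.2 ⟨hsA, hEs hsE⟩
        have hs1 := card_pos.2 ⟨s, hsI⟩
        have hik := H.card_le hE
        have hAk : #(A ∩ Icc 1 s) ≤ k := by
          rw [← H.nontrivial.card_eq A hA]
          exact card_le_card inter_subset_left
        have hg := H.ground
        obtain ⟨D, hD, hDk, hDs⟩ := exists_inter_Icc_eq (n := n) (k := k) H.le_n
          ((erase_subset s _).trans (inter_subset_right (s₁ := A)))
          (by rw [card_erase_of_mem hsI]; omega) (by rw [card_erase_of_mem hsI]; omega)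
        have hDF : D ∈ 𝓕 := by
          by_contra hDF
          exact hcr (mem_criticalTraces.2 ⟨⟨inter_subset_right, by omega⟩, hsI, ⟨A, hA, rfl⟩,
            D, hD, hDk, hDs, hDF⟩)
        have h1 := H.le_card_inter hC hDF
        have h2 : C ∩ D ∩ Icc 1 s ⊆ (E ∩ A).erase s := by
          rw [← hCE]
          intro x hx
          simp only [mem_inter] at hx
          have h3 : x ∈ D ∩ Icc 1 s := mem_inter.2 ⟨hx.1.2, hx.2⟩
          rw [hDs, mem_erase, mem_inter] at h3
          simp only [mem_erase, mem_inter]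
          tauto
        have h3 := card_le_card h2
        rw [card_erase_of_mem (mem_inter.2 ⟨hsE, hsA⟩)] at h3
        have := card_pos.2 ⟨s, mem_inter.2 ⟨hsE, hsA⟩⟩
        omega
    · exact H.lt_card_inter hE hA hsA hc
  · rw [erase_eq_of_notMem fun h => hsA (mem_inter.1 h).2, ← hCE, inter_right_comm]
    exact H.le_card_inter hC hA

/-- Comparing `𝓕` with the family where the members with trace in `𝒴` are removed and all
`k`-sets with trace `E \ {s}`, `E ∈ 𝒳`, are added. -/
theorem ShiftedGenerated.card_mul_choose_le (H : ShiftedGenerated n k t s 𝓕)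
    (hmax : IsLargest n k t 𝓕) (hij : i + j = s + t)
    (hX : 𝒳 ⊆ criticalTraces n k s 𝓕 i) (hY : 𝒴 ⊆ criticalTraces n k s 𝓕 j)
    (hXX : ∀ E ∈ 𝒳, ∀ E' ∈ 𝒳, t + 1 ≤ #(E ∩ E'))
    (hXY : ∀ E ∈ 𝒳, ∀ E' ∈ criticalTraces n k s 𝓕 j, E' ∉ 𝒴 → t + 1 ≤ #(E ∩ E'))
    (hnt : ∀ T : Finset ℕ, (∀ A ∈ 𝓕, A ∩ Icc 1 s ∉ 𝒴 → T ⊆ A) → #T < t) :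
    #𝒳 * (n - s).choose (k + 1 - i) ≤ #𝒴 * (n - s).choose (k - j) := by
  set 𝒩 := 𝒳.biUnion fun E => {B ∈ (Icc 1 n).powersetCard k | B ∩ Icc 1 s = E.erase s}
    with h𝒩
  have hmem : ∀ B, B ∈ 𝒩 ↔ ∃ E ∈ 𝒳, (B ⊆ Icc 1 n ∧ #B = k) ∧ B ∩ Icc 1 s = E.erase s := by
    intro B
    simp [h𝒩, mem_powersetCard]
  have hcardN : #𝒩 = #𝒳 * (n - s).choose (k + 1 - i) := by
    rw [h𝒩, card_biUnion, sum_const_nat]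
    · intro E hE
      have hEc := mem_criticalTraces.1 (hX hE)
      have hik := H.card_le (hX hE)
      have h1 := card_pos.2 ⟨s, hEc.2.1⟩
      have h2 := card_erase_of_mem hEc.2.1
      rw [card_filter_inter_eq ((erase_subset _ _).trans hEc.1.1)
        (Icc_subset_Icc_right H.le_n) (by omega), h2, Nat.card_Icc, Nat.card_Icc]
      congr 1
      omega
    · intro E hE E' hE' hne
      refine disjoint_left.2 fun B hB hB' => ?_
      rw [mem_filter] at hB hB'
      apply hne
      rw [← insert_erase (mem_criticalTraces.1 (hX hE)).2.1,
        ← insert_erase (mem_criticalTraces.1 (hX hE')).2.1, ← hB.2, ← hB'.2]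
  have hcardY : #{A ∈ 𝓕 | A ∩ Icc 1 s ∈ 𝒴} ≤ #𝒴 * (n - s).choose (k - j) := by
    refine (card_le_card (t := 𝒴.biUnion fun E =>
      {B ∈ (Icc 1 n).powersetCard k | B ∩ Icc 1 s = E}) ?_).trans
      (card_biUnion_le_card_mul _ _ _ ?_)
    · intro A hA
      rw [mem_filter] at hA
      exact mem_biUnion.2 ⟨_, hA.2, mem_filter.2 ⟨mem_powersetCard.2
        ⟨H.nontrivial.subset A hA.1, H.nontrivial.card_eq A hA.1⟩, rfl⟩⟩
    · intro E hE
      have hEc := mem_criticalTraces.1 (hY hE)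
      have hjk := H.card_le (hY hE)
      rw [card_filter_inter_eq hEc.1.1 (Icc_subset_Icc_right H.le_n) (by omega), hEc.1.2,
        Nat.card_Icc, Nat.card_Icc]
      rfl
  have hold : ∀ B ∈ 𝒩, ∀ A ∈ 𝓕, A ∩ Icc 1 s ∉ 𝒴 → t ≤ #(B ∩ A) := by
    intro B hB A hA hAY
    obtain ⟨E, hE, -, hBE⟩ := (hmem B).1 hB
    exact H.le_card_inter_of_trace hij (hX hE) hBE hA fun h => hXY E hE _ h hAY
  have hnew : ∀ B ∈ 𝒩, ∀ A ∈ 𝒩, t ≤ #(B ∩ A) := by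
    intro B hB A hA
    obtain ⟨E, hE, -, hBE⟩ := (hmem B).1 hB
    obtain ⟨E', hE', -, hAE⟩ := (hmem A).1 hA
    have h1 : (E ∩ E').erase s ⊆ B ∩ A := by
      intro x hx
      rw [mem_erase, mem_inter] at hx
      have h2 : x ∈ B ∩ Icc 1 s := by
        rw [hBE]
        exact mem_erase.2 ⟨hx.1, hx.2.1⟩
      have h3 : x ∈ A ∩ Icc 1 s := by
        rw [hAE]
        exact mem_erase.2 ⟨hx.1, hx.2.2⟩
      exact mem_inter.2 ⟨(mem_inter.1 h2).1, (mem_inter.1 h3).1⟩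
    have h2 := card_le_card h1
    rw [card_erase_of_mem (mem_inter.2 ⟨(mem_criticalTraces.1 (hX hE)).2.1,
      (mem_criticalTraces.1 (hX hE')).2.1⟩)] at h2
    have := hXX E hE E' hE'
    omega
  have hG : NontrivialIntersecting n k t ({A ∈ 𝓕 | A ∩ Icc 1 s ∉ 𝒴} ∪ 𝒩) := by
    refine ⟨fun A hA => ?_, fun A hA => ?_, fun A hA B hB => ?_, fun T hT => hnt T ?_⟩
    · rw [mem_union, mem_filter, hmem] at hA
      rcases hA with hA | ⟨E, -, hA, -⟩
      exacts [H.nontrivial.subset A hA.1, hA.1]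
    · rw [mem_union, mem_filter, hmem] at hA
      rcases hA with hA | ⟨E, -, hA, -⟩
      exacts [H.nontrivial.card_eq A hA.1, hA.2]
    · rw [mem_union, mem_filter] at hA hB
      rcases hA with hA | hA <;> rcases hB with hB | hB
      · exact H.nontrivial.le_card_inter A hA.1 B hB.1
      · rw [inter_comm]
        exact hold B hB A hA.1 hA.2
      · exact hold A hA B hB.1 hB.2
      · exact hnew A hA B hB
    · exact fun A hA hAY => hT A (mem_union_left _ (mem_filter.2 ⟨hA, hAY⟩))
  have h1 := hmax.2 _ hG
  rw [card_union_of_disjoint] at h1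
  · have h2 := card_filter_add_card_filter_not (s := 𝓕) (fun A => A ∩ Icc 1 s ∈ 𝒴)
    omega
  · rw [disjoint_left]
    intro A hA hAN
    obtain ⟨E, hE, -, hAE⟩ := (hmem A).1 hAN
    exact H.trace_ne (hX hE) (mem_filter.1 hA).1 hAE

end

section

variable {n k t s i j : ℕ} {𝓕 : Finset (Finset ℕ)}

theorem two_mul_add_two_le (ht : 1 ≤ t) (hk : t + 2 ≤ k)
    (hn : (t + 3) * (k + 1 - t) < 2 * n) : 2 * k + 2 ≤ n + t := by
  obtain ⟨c, rfl⟩ := Nat.exists_eq_add_of_le hk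
  obtain ⟨u, rfl⟩ := Nat.exists_eq_add_of_le ht
  have h1 : 1 + u + 2 + c + 1 - (1 + u) = c + 3 := by omega
  rw [h1] at hn
  rcases Nat.eq_zero_or_pos u with rfl | hu
  · omega
  · nlinarith [Nat.zero_le (u * c)]

theorem mul_lt_mul_of_two_le_sub {r c : ℕ} (ht : 1 ≤ t) (hr : 2 ≤ r) (hrc : r ≤ c)
    (hn : (t + 3) * (c + 1) < 2 * n) (hn' : t + r + c ≤ n) :
    (r + t - 1) * (c + 1 - r) < r * (n - (t + r + c)) := by
  zify [ht, hn', show r ≤ c + 1 by omega, show 1 ≤ r + t by omega]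
  zify at hn hr ht
  have h1 : (0 : ℤ) ≤ (r - 2) * (t - 1) := mul_nonneg (by omega) (by omega)
  have h2 : (0 : ℤ) ≤ (c + 1) * ((r - 2) * (t - 1)) := mul_nonneg (by omega) h1
  have h3 : (r : ℤ) * ((t + 3) * (c + 1)) < r * (2 * n) :=
    mul_lt_mul_of_pos_left hn (by omega)
  nlinarith

theorem sum_card_filter_notMem_Icc {m p : ℕ} {𝒰 : Finset (Finset ℕ)}
    (h : ∀ E ∈ 𝒰, #(Icc 1 m ∩ E) = p) :
    ∑ a ∈ Icc 1 m, #{E ∈ 𝒰 | a ∉ E} = #𝒰 * (m - p) := by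
  refine (sum_card_bipartiteAbove_eq_sum_card_bipartiteBelow (fun a E => a ∉ E)).trans
    (sum_const_nat fun E hE => ?_)
  have h1 : bipartiteBelow (fun a E => a ∉ E) (Icc 1 m) E = Icc 1 m \ E := by
    ext x
    simp [bipartiteBelow]
  have h2 := card_sdiff_add_card_inter (Icc 1 m) E
  rw [Nat.card_Icc, h E hE] at h2
  rw [h1]
  omega

theorem sum_card_filter_mem_Icc {m p : ℕ} {𝒰 : Finset (Finset ℕ)}
    (h : ∀ E ∈ 𝒰, #(Icc 1 m ∩ E) = p) :
    ∑ a ∈ Icc 1 m, #{E ∈ 𝒰 | a ∈ E} = #𝒰 * p := by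
  refine (sum_card_bipartiteAbove_eq_sum_card_bipartiteBelow (fun a E => a ∈ E)).trans
    (sum_const_nat fun E hE => ?_)
  rw [← h E hE]
  congr 1

theorem ShiftedGenerated.criticalTraces_eq_empty_of_two_mul (H : ShiftedGenerated n k t s 𝓕)
    (hmax : IsLargest n k t 𝓕) (ht : 1 ≤ t) (hn : (t + 3) * (k + 1 - t) < 2 * n)
    (hi : 2 * i = s + t) (his : i + 2 ≤ s) : criticalTraces n k s 𝓕 i = ∅ := by
  by_contra hne
  obtain ⟨E₀, hE₀⟩ := nonempty_iff_ne_empty.2 hne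
  have hik := H.card_le hE₀
  have hti := H.lt_card hE₀
  have hsub := H.lt_sub hE₀
  have hg := H.ground
  have hsn := H.le_n
  have hcard : ∀ E ∈ criticalTraces n k s 𝓕 i, #(Icc 1 (s - 1) ∩ E) = i - 1 := by
    intro E hE
    obtain ⟨⟨hEs, hEi⟩, hsE, -⟩ := mem_criticalTraces.1 hE
    rw [← hEi, ← card_erase_of_mem hsE]
    congr 1
    ext x
    have := @hEs x
    simp only [mem_inter, mem_erase, mem_Icc] at this ⊢
    constructor
    · rintro ⟨h1, h2⟩
      exact ⟨by omega, h2⟩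
    · rintro ⟨h1, h2⟩
      have := this h2
      exact ⟨by omega, h2⟩
  have hinter : ∀ a ∈ Icc 1 (s - 1), ∀ E ∈ criticalTraces n k s 𝓕 i, a ∉ E →
      ∀ E' ∈ criticalTraces n k s 𝓕 i, a ∉ E' → t + 1 ≤ #(E ∩ E') := by
    intro a ha E hE haE E' hE' haE'
    have h1 := (mem_criticalTraces.1 hE).1
    have h2 := (mem_criticalTraces.1 hE').1
    have h3 : E ∪ E' ⊆ (Icc 1 s).erase a := subset_erase.2
      ⟨union_subset h1.1 h2.1, fun h => (mem_union.1 h).elim haE haE'⟩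
    have h4 := card_le_card h3
    rw [mem_Icc] at ha
    rw [card_erase_of_mem (mem_Icc.2 (by omega)), Nat.card_Icc] at h4
    have h5 := card_union_add_card_inter E E'
    omega
  have hle : ∀ a ∈ Icc 1 (s - 1),
      #{E ∈ criticalTraces n k s 𝓕 i | a ∉ E} * (n - s).choose (k + 1 - i) ≤
      #{E ∈ criticalTraces n k s 𝓕 i | a ∈ E} * (n - s).choose (k - i) := by
    intro a ha
    refine H.card_mul_choose_le hmax (by omega) (filter_subset _ _) (filter_subset _ _) ?_ ?_ ?_
    · intro E hE E' hE'
      rw [mem_filter] at hE hE'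
      exact hinter a ha E hE.1 hE.2 E' hE'.1 hE'.2
    · intro E hE E' hE' hE''
      rw [mem_filter] at hE hE''
      exact hinter a ha E hE.1 hE.2 E' hE' fun h => hE'' ⟨hE', h⟩
    · intro T hT
      refine H.card_lt_of_forall his fun A hA hAi => hT A hA fun hc => hAi ?_
      have h1 := mem_criticalTraces.1 (mem_filter.1 hc).1
      exact ⟨(mem_inter.1 h1.2.1).1, h1.1.2⟩
  have hsum := sum_le_sum hle
  rw [← sum_mul, ← sum_mul, sum_card_filter_notMem_Icc hcard, sum_card_filter_mem_Icc hcard,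
    mul_assoc, mul_assoc] at hsum
  have hU := card_pos.2 ⟨E₀, hE₀⟩
  have h1 := Nat.le_of_mul_le_mul_left hsum hU
  have h2 := Nat.choose_succ_right_eq (n - s) (k - i)
  rw [show k - i + 1 = k + 1 - i by omega] at h2
  have hpos : 0 < (n - s).choose (k - i) := Nat.choose_pos (by omega)
  have h3 : (s - 1 - (i - 1)) * (n - s - (k - i)) ≤ (i - 1) * (k + 1 - i) := by
    refine Nat.le_of_mul_le_mul_left ?_ hpos
    calc (n - s).choose (k - i) * ((s - 1 - (i - 1)) * (n - s - (k - i)))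
        = (s - 1 - (i - 1)) * (n - s).choose (k + 1 - i) * (k + 1 - i) := by
          rw [mul_assoc, h2]
          ring
      _ ≤ (i - 1) * (n - s).choose (k - i) * (k + 1 - i) := Nat.mul_le_mul_right _ h1
      _ = _ := by ring
  have h4 := mul_lt_mul_of_two_le_sub (n := n) (t := t) (r := i - t) (c := k - t) ht (by omega)
    (by omega) (by rwa [show k - t + 1 = k + 1 - t by omega]) (by omega)
  rw [show i - t + t - 1 = i - 1 by omega, show k - t + 1 - (i - t) = k + 1 - i by omega,
    show n - (t + (i - t) + (k - t)) = n - s - (k - i) by omega,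
    show i - t = s - 1 - (i - 1) by omega] at h4
  omega

theorem ShiftedGenerated.criticalTraces_nonempty_of_add (H : ShiftedGenerated n k t s 𝓕)
    (hmax : IsLargest n k t 𝓕) (hij : i + j = s + t) (hne : (criticalTraces n k s 𝓕 i).Nonempty) :
    (criticalTraces n k s 𝓕 j).Nonempty := by
  by_contra hc
  obtain ⟨E, hE⟩ := hne
  have h1 := H.card_mul_choose_le hmax hij (singleton_subset_iff.2 hE) (empty_subset _) ?_ ?_ ?_
  · rw [card_singleton, card_empty, zero_mul, one_mul] at h1
    have h2 := H.lt_sub hE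
    have h3 := H.le_n
    have := Nat.choose_pos (n := n - s) (k := k + 1 - i) (by omega)
    omega
  · intro E₁ h₁ E₂ h₂
    rw [mem_singleton.1 h₁, mem_singleton.1 h₂, inter_self, (mem_criticalTraces.1 hE).1.2]
    exact H.lt_card hE
  · exact fun _ _ E' hE' => absurd ⟨E', hE'⟩ hc
  · exact fun T hT => H.nontrivial.card_lt T fun A hA => hT A hA (notMem_empty _)

theorem ShiftedGenerated.card_criticalTraces_mul_le (H : ShiftedGenerated n k t s 𝓕)
    (hmax : IsLargest n k t 𝓕) (hij : i + j = s + t) (hne : i ≠ j) (hj : j + 2 ≤ s) :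
    #(criticalTraces n k s 𝓕 i) * (n - s).choose (k + 1 - i) ≤
      #(criticalTraces n k s 𝓕 j) * (n - s).choose (k - j) := by
  refine H.card_mul_choose_le hmax hij subset_rfl subset_rfl ?_ ?_ ?_
  · intro E hE E' hE'
    obtain ⟨⟨hEs', hi'⟩, hsE', ⟨A, hA, rfl⟩, -⟩ := mem_criticalTraces.1 hE'
    exact (H.lt_card_inter hE hA (mem_inter.1 hsE').1 (by omega)).trans_eq (by
      rw [← inter_assoc, inter_right_comm,
        inter_eq_left.2 (mem_criticalTraces.1 hE).1.1])
  · exact fun _ _ E' hE' h => absurd hE' h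
  · intro T hT
    refine H.card_lt_of_forall hj fun A hA hAi => hT A hA fun hc => hAi ?_
    have h1 := mem_criticalTraces.1 hc
    exact ⟨(mem_inter.1 h1.2.1).1, h1.1.2⟩

theorem ShiftedGenerated.criticalTraces_eq_empty_of_ne (H : ShiftedGenerated n k t s 𝓕)
    (hmax : IsLargest n k t 𝓕) (hij : i + j = s + t) (hne : i ≠ j) (hi : i + 2 ≤ s)
    (hj : j + 2 ≤ s) : criticalTraces n k s 𝓕 i = ∅ := by
  by_contra hne0
  have hU := nonempty_iff_ne_empty.2 hne0
  have hV := H.criticalTraces_nonempty_of_add hmax hij hU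
  have h1 := H.card_criticalTraces_mul_le hmax hij hne hj
  have h2 := H.card_criticalTraces_mul_le hmax (add_comm i j ▸ hij) hne.symm hi
  have hUp := card_pos.2 hU
  have hVp := card_pos.2 hV
  obtain ⟨E, hE⟩ := hU
  obtain ⟨E', hE'⟩ := hV
  have hik := H.card_le hE
  have hjk := H.card_le hE'
  have hil := H.lt_sub hE
  have hjl := H.lt_sub hE'
  have hg := H.ground
  have hsn := H.le_n
  have c1 := Nat.choose_succ_right_eq (n - s) (k - i)
  have c2 := Nat.choose_succ_right_eq (n - s) (k - j)
  rw [show k - i + 1 = k + 1 - i by omega] at c1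
  rw [show k - j + 1 = k + 1 - j by omega] at c2
  have p1 : 0 < (n - s).choose (k - i) := Nat.choose_pos (by omega)
  have p2 : 0 < (n - s).choose (k - j) := Nat.choose_pos (by omega)
  have l1 : k + 1 - j < n - s - (k - i) := by omega
  have l2 : k + 1 - i < n - s - (k - j) := by omega
  generalize #(criticalTraces n k s 𝓕 i) = u at *
  generalize #(criticalTraces n k s 𝓕 j) = v at *
  generalize (n - s).choose (k - i) = x at *
  generalize (n - s).choose (k - j) = y at *
  generalize (n - s).choose (k + 1 - i) = x' at *
  generalize (n - s).choose (k + 1 - j) = y' at *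
  have q1 : 0 < k + 1 - i := by omega
  have q2 : 0 < k + 1 - j := by omega
  generalize k + 1 - i = a at *
  generalize k + 1 - j = b at *
  generalize n - s - (k - i) = a' at *
  generalize n - s - (k - j) = b' at *
  clear * - h1 h2 hUp hVp c1 c2 p1 p2 l1 l2 q1 q2
  have e1 : (u * x') * (v * y') ≤ (v * y) * (u * x) := Nat.mul_le_mul h1 h2
  have e2 : u * v * (x * y) * (a' * b') ≤ u * v * (x * y) * (a * b) := by
    calc u * v * (x * y) * (a' * b') = u * v * ((x * a') * (y * b')) := by ring
      _ = (u * x') * (v * y') * (a * b) := by rw [← c1, ← c2]; ring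
      _ ≤ (v * y) * (u * x) * (a * b) := Nat.mul_le_mul_right _ e1
      _ = _ := by ring
  have e3 := Nat.le_of_mul_le_mul_left e2 (by positivity)
  have e4 : b * a < a' * b' := Nat.mul_lt_mul'' l1 l2
  rw [mul_comm] at e4
  omega

end

section

variable {n k t s i j : ℕ} {𝓕 : Finset (Finset ℕ)}

theorem IsShifted.forall_mem_insert_erase (h : IsShifted n 𝓕) {D : Finset ℕ}
    (hD : ∀ B ⊆ Icc 1 n, #B = k → D ⊆ B → B ∈ 𝓕) {a b : ℕ} (ha : 1 ≤ a) (hab : a < b)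
    (hbn : b ≤ n) (haD : a ∉ D) :
    ∀ B ⊆ Icc 1 n, #B = k → insert a (D.erase b) ⊆ B → B ∈ 𝓕 := by
  intro B hB hBk hDB
  have haB : a ∈ B := hDB (mem_insert_self _ _)
  by_cases hbB : b ∈ B
  · refine hD B hB hBk fun x hx => ?_
    by_cases hxb : x = b
    · rwa [hxb]
    · exact hDB (mem_insert_of_mem (mem_erase.2 ⟨hxb, hx⟩))
  · have hbB' : b ∉ B.erase a := fun h => hbB (mem_of_mem_erase h)
    have h1 : insert b (B.erase a) ∈ 𝓕 := by
      refine hD _ (insert_subset (mem_Icc.2 ⟨by omega, hbn⟩) ((erase_subset _ _).trans hB)) ?_ ?_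
      · rw [card_insert_of_notMem hbB', card_erase_of_mem haB]
        have := card_pos.2 ⟨a, haB⟩
        omega
      · intro x hx
        rw [mem_insert, mem_erase]
        by_cases hxb : x = b
        · exact Or.inl hxb
        · exact Or.inr ⟨fun h => haD (h ▸ hx),
            hDB (mem_insert_of_mem (mem_erase.2 ⟨hxb, hx⟩))⟩
    have h2 := h a b ha hab hbn _ h1 (mem_insert_self _ _) (by simp [hab.ne])
    rwa [erase_insert hbB', insert_erase haB] at h2

theorem mem_standardFamily_Icc {A : Finset ℕ} (hA : A ⊆ Icc 1 n) (hAk : #A = k)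
    (h₁ : t + 1 ≤ #(A ∩ Icc 1 s))
    (h₂ : ∀ y ∈ Icc (t + 1) s, t ≤ #(A ∩ insert y (Icc 1 t))) :
    A ∈ standardFamily n k (Icc 1 t) (Icc (t + 1) s) := by
  rw [mem_standardFamily]
  refine ⟨⟨hA, hAk⟩, ?_⟩
  by_cases hT : Icc 1 t ⊆ A
  · refine Or.inl ⟨hT, ?_⟩
    by_contra hc
    rw [not_nonempty_iff_eq_empty] at hc
    have h3 : A ∩ Icc 1 s ⊆ Icc 1 t := by
      intro x hx
      rw [mem_inter, mem_Icc] at hx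
      rw [mem_Icc]
      by_contra hxt
      have : x ∈ A ∩ Icc (t + 1) s := mem_inter.2 ⟨hx.1, mem_Icc.2 (by omega)⟩
      simp [hc] at this
    have := card_le_card h3
    rw [Nat.card_Icc] at this
    omega
  · right
    have h3 : #(A ∩ Icc 1 t) < t := by
      have h4 : A ∩ Icc 1 t ⊂ Icc 1 t :=
        ⟨inter_subset_right, fun h => hT fun x hx => (mem_inter.1 (h hx)).1⟩
      simpa using card_lt_card h4
    have hZ : Icc (t + 1) s ⊆ A := by
      intro y hy
      by_contra hyA
      have := h₂ y hy
      rw [inter_insert_of_notMem hyA] at this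
      omega
    refine ⟨hZ, ?_⟩
    by_cases hy : t + 1 ≤ s
    · have hyI := left_mem_Icc.2 hy
      have := h₂ _ hyI
      rw [inter_insert_of_mem (hZ hyI)] at this
      have := card_insert_le (t + 1) (A ∩ Icc 1 t)
      rw [Nat.card_Icc]
      omega
    · have : #(A ∩ Icc 1 s) ≤ #(A ∩ Icc 1 t) :=
        card_le_card (inter_subset_inter_left (Icc_subset_Icc_right (by omega)))
      omega

theorem le_card_inter_insert {A : Finset ℕ} {y : ℕ} (h : t + 1 ≤ #(A ∩ Icc 1 (t + 2)))
    (hy : y ∈ Icc (t + 1) (t + 2)) : t ≤ #(A ∩ insert y (Icc 1 t)) := by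
  have h2 : A ∩ Icc 1 (t + 2) ⊆
      insert (if y = t + 1 then t + 2 else t + 1) (A ∩ insert y (Icc 1 t)) := by
    intro x hx
    simp only [mem_inter, mem_insert, mem_Icc] at hx hy ⊢
    simp only [hx.1, true_and]
    split_ifs <;> omega
  have h3 := h.trans ((card_le_card h2).trans (card_insert_le _ _))
  omega

theorem disjoint_Icc_Icc_succ (t s : ℕ) : Disjoint (Icc 1 t) (Icc (t + 1) s) := by
  rw [disjoint_left]
  intro x hx hx'
  rw [mem_Icc] at hx hx'
  omega

theorem IsLargest.exists_eq_standardFamily (h : IsLargest n k t 𝓕) (ht : 1 ≤ t)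
    (hk : t + 2 ≤ k) (hkn : k + 1 ≤ n) (hs : t + 2 ≤ s) (hsn : s ≤ n)
    (h₁ : ∀ A ∈ 𝓕, t + 1 ≤ #(A ∩ Icc 1 s))
    (h₂ : ∀ A ∈ 𝓕, ∀ y ∈ Icc (t + 1) s, t ≤ #(A ∩ insert y (Icc 1 t))) :
    ∃ T Z, T ⊆ Icc 1 n ∧ Z ⊆ Icc 1 n ∧ Disjoint T Z ∧ #T = t ∧ 2 ≤ #Z ∧ t + #Z ≤ k + 1 ∧
      𝓕 = standardFamily n k T Z := by
  have hsub : 𝓕 ⊆ standardFamily n k (Icc 1 t) (Icc (t + 1) s) := fun A hA =>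
    mem_standardFamily_Icc (h.1.subset A hA) (h.1.card_eq A hA) (h₁ A hA) (h₂ A hA)
  have hT : Icc 1 t ⊆ Icc 1 n := Icc_subset_Icc_right (by omega)
  have hZ : Icc (t + 1) s ⊆ Icc 1 n := Icc_subset_Icc (by omega) hsn
  have hTt : #(Icc 1 t) = t := by simp
  have hZs : #(Icc (t + 1) s) = s - t := by simp
  have hsk : s ≤ k + 1 := by
    obtain ⟨A, hA, hTA⟩ : ∃ A ∈ 𝓕, ¬ Icc 1 t ⊆ A := by
      by_contra hc
      push Not at hc
      exact (h.1.card_lt _ hc).ne hTt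
    obtain ⟨-, h3 | ⟨h3, h4⟩⟩ := mem_standardFamily.1 (hsub hA)
    · exact absurd h3.1 hTA
    · have h5 : (A ∩ Icc 1 t) ∪ Icc (t + 1) s ⊆ A := union_subset inter_subset_left h3
      have h6 := card_le_card h5
      rw [card_union_of_disjoint ((disjoint_Icc_Icc_succ t s).mono_left inter_subset_right),
        h.1.card_eq A hA] at h6
      omega
  refine ⟨_, _, hT, hZ, disjoint_Icc_Icc_succ t s, hTt, by omega, by omega, ?_⟩
  exact h.eq_of_subset (nontrivialIntersecting_standardFamily hT hZ (disjoint_Icc_Icc_succ t s)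
    hTt ht (by omega) (by omega) (by omega) hkn) hsub

theorem ShiftedGenerated.exists_eq_standardFamily_of_criticalTraces
    (H : ShiftedGenerated n k t s 𝓕) (hmax : IsLargest n k t 𝓕) (ht : 1 ≤ t) (hk : t + 2 ≤ k)
    (hs : t + 2 ≤ s) (hne : (criticalTraces n k s 𝓕 (t + 1)).Nonempty) :
    ∃ T Z, T ⊆ Icc 1 n ∧ Z ⊆ Icc 1 n ∧ Disjoint T Z ∧ #T = t ∧ 2 ≤ #Z ∧ t + #Z ≤ k + 1 ∧
      𝓕 = standardFamily n k T Z := by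
  obtain ⟨E, hE⟩ := hne
  obtain ⟨⟨hEs, hEt⟩, hsE, -⟩ := mem_criticalTraces.1 hE
  have hg := H.ground
  have hsn := H.le_n
  have hup : ∀ B ⊆ Icc 1 n, #B = k → insert s (Icc 1 t) ⊆ B → B ∈ 𝓕 := by
    have key := of_forall_insert_erase (lo := 1) (D := E.erase s)
      (Q := fun D => D ⊆ Icc 1 (s - 1) ∧ ∀ B ⊆ Icc 1 n, #B = k → insert s D ⊆ B → B ∈ 𝓕)
      ?_ ⟨?_, ?_⟩ ?_
    · rw [card_erase_of_mem hsE, hEt] at key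
      have := key.2
      rwa [show Ico 1 (1 + (t + 1 - 1)) = Icc 1 t by ext; simp; omega] at this
    · rintro D ⟨hD, hDF⟩ a b ha hab hb haD
      have hbs := mem_Icc.1 (hD hb)
      refine ⟨insert_subset (mem_Icc.2 (by omega)) ((erase_subset _ _).trans hD), ?_⟩
      have has : a ∉ insert s D := by
        rw [mem_insert, not_or]
        exact ⟨by omega, haD⟩
      have := H.shifted.forall_mem_insert_erase hDF ha hab (by omega) has
      rwa [erase_insert_of_ne (by omega), insert_comm] at this
    · intro x hx
      rw [mem_erase] at hx
      have := mem_Icc.1 (hEs hx.2)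
      exact mem_Icc.2 (by omega)
    · rw [insert_erase hsE]
      exact fun B hB hBk => H.mem_of_subset hE hB hBk
    · exact fun x hx => (mem_Icc.1 (hEs (mem_of_mem_erase hx))).1
  refine hmax.exists_eq_standardFamily ht hk (by omega) hs hsn (fun A hA =>
    lt_card_trace H.nontrivial H.shifted H.generated hg hA) fun A hA y hy => ?_
  rw [mem_Icc] at hy
  have hyn : y ∉ Icc 1 t := by
    rw [mem_Icc]
    omega
  have hyup : ∀ B ⊆ Icc 1 n, #B = k → insert y (Icc 1 t) ⊆ B → B ∈ 𝓕 := by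
    rcases hy.2.eq_or_lt with rfl | hys
    · exact hup
    · have := H.shifted.forall_mem_insert_erase hup (a := y) (by omega) hys hsn
        (by rw [mem_insert, not_or]; exact ⟨by omega, hyn⟩)
      rwa [erase_insert (by rw [mem_Icc]; omega)] at this
  have hc : #(insert y (Icc 1 t)) = t + 1 := by
    rw [card_insert_of_notMem hyn, Nat.card_Icc]
    omega
  have hlt := H.lt_sub hE
  obtain ⟨B, hB, hBk, hBt⟩ := exists_inter_Icc_eq (n := n) (k := k) (D := insert y (Icc 1 t)) hsn
    (insert_subset (mem_Icc.2 (by omega)) (Icc_subset_Icc_right (by omega))) (by omega) (by omega)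
  have h1 := H.le_card_inter hA (hyup B hB hBk (hBt ▸ inter_subset_left))
  rwa [inter_assoc, hBt] at h1

/-- A largest nontrivial `t`-intersecting family that is stable under all compressions. -/
theorem IsLargest.exists_eq_standardFamily_of_isShifted (h : IsLargest n k t 𝓕)
    (hsh : IsShifted n 𝓕) (ht : 1 ≤ t) (hk : t + 2 ≤ k)
    (hn : (t + 3) * (k + 1 - t) < 2 * n) :
    ∃ T Z, T ⊆ Icc 1 n ∧ Z ⊆ Icc 1 n ∧ Disjoint T Z ∧ #T = t ∧ 2 ≤ #Z ∧ t + #Z ≤ k + 1 ∧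
      𝓕 = standardFamily n k T Z := by
  have hg := two_mul_add_two_le ht hk hn
  by_cases hgen : IsGenerated n k (t + 2) 𝓕
  · have h1 : ∀ A ∈ 𝓕, t + 1 ≤ #(A ∩ Icc 1 (t + 2)) := fun A hA =>
      lt_card_trace h.1 hsh hgen hg hA
    exact h.exists_eq_standardFamily ht hk (by omega) le_rfl (by omega) h1 fun A hA y hy =>
      le_card_inter_insert (h1 A hA) hy
  · classical
    have hex : ∃ s, IsGenerated n k s 𝓕 := ⟨n, h.1.isGenerated⟩
    obtain ⟨s, hs, hmin⟩ : ∃ s, IsGenerated n k s 𝓕 ∧ ∀ m < s, ¬ IsGenerated n k m 𝓕 :=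
      ⟨Nat.find hex, Nat.find_spec hex, fun m hm => Nat.find_min hex hm⟩
    have hst : t + 3 ≤ s := by
      by_contra hc
      exact hgen (hs.mono (by omega))
    have hsn : s ≤ n := by
      by_contra hc
      exact hmin n (by omega) h.1.isGenerated
    have H : ShiftedGenerated n k t s 𝓕 := ⟨h.1, hsh, hs, hsn, hg⟩
    obtain ⟨i, E, hE⟩ := H.exists_mem_criticalTraces (by omega) (hmin _ (by omega))
    have hi := card_le_of_mem_criticalTraces hE
    obtain ⟨j, hij⟩ : ∃ j, i + j = s + t := ⟨s + t - i, by omega⟩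
    have hi' := H.lt_card hE
    have hne : (criticalTraces n k s 𝓕 i).Nonempty := ⟨E, hE⟩
    obtain ⟨E', hE'⟩ := H.criticalTraces_nonempty_of_add h hij hne
    have hj' := H.lt_card hE'
    by_cases heq : i = j
    · rw [H.criticalTraces_eq_empty_of_two_mul h ht hn (by omega) (by omega)] at hE
      simp at hE
    · by_cases hi1 : i = t + 1
      · exact H.exists_eq_standardFamily_of_criticalTraces h ht hk (by omega) (hi1 ▸ hne)
      · by_cases hj1 : j = t + 1
        · exact H.exists_eq_standardFamily_of_criticalTraces h ht hk (by omega) (hj1 ▸ ⟨E', hE'⟩)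
        · rw [H.criticalTraces_eq_empty_of_ne h hij heq (by omega) (by omega)] at hE
          simp at hE

end

/-- Families of the shape `standardFamily` with one of the two extremal sizes of `Z`. -/
def IsStandard (n k t : ℕ) (𝓕 : Finset (Finset ℕ)) : Prop :=
  ∃ T Z, T ⊆ Icc 1 n ∧ Z ⊆ Icc 1 n ∧ Disjoint T Z ∧ #T = t ∧ (#Z = 2 ∨ t + #Z = k + 1) ∧
    𝓕 = standardFamily n k T Z

section

variable {n k t i j : ℕ} {𝓕 : Finset (Finset ℕ)}

theorem isStandard_of_shift (ht : 1 ≤ t) (hk : t + 2 ≤ k) (hn : 2 * k + 2 ≤ n + t)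
    (hi : i ∈ Icc 1 n) (hj : j ∈ Icc 1 n) (h𝓕 : ∀ A ∈ 𝓕, ∀ B ∈ 𝓕, t ≤ #(A ∩ B))
    (h : IsStandard n k t (shift i j 𝓕)) : IsStandard n k t 𝓕 := by
  obtain ⟨T, Z, hT, hZ, hTZ, hTt, hZc, h⟩ := h
  obtain ⟨T', Z', hT', hZ', hTZ', hTt', hZc', h'⟩ := exists_eq_standardFamily_of_shift_eq hT hZ
    hTZ hTt ht (by omega) (by omega) hk hn hi hj h𝓕 h
  exact ⟨T', Z', hT', hZ', hTZ', hTt', by omega, h'⟩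

theorem IsStandard.isStandard_permute (h : IsStandard n k t 𝓕) {σ : Equiv.Perm ℕ}
    (hσ : ∀ x, x ∉ Icc 1 n → σ x = x) : IsStandard n k t (permute σ 𝓕) := by
  obtain ⟨T, Z, hT, hZ, hTZ, hTt, hZc, rfl⟩ := h
  refine ⟨T.image σ, Z.image σ, image_perm_subset hσ hT, image_perm_subset hσ hZ,
    (disjoint_image σ.injective).2 hTZ, ?_, ?_, permute_standardFamily hσ⟩
  · rwa [card_image_of_injective _ σ.injective]
  · rwa [card_image_of_injective _ σ.injective]

theorem isStandard_of_permute {σ : Equiv.Perm ℕ} (hσ : ∀ x, x ∉ Icc 1 n → σ x = x)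
    (h : IsStandard n k t (permute σ 𝓕)) : IsStandard n k t 𝓕 := by
  have := h.isStandard_permute (perm_symm_fix hσ)
  rwa [permute_permute, show σ.symm * σ = 1 from inv_mul_cancel σ, permute_one] at this

theorem IsLargest.isStandard_of_shift_eq (h : IsLargest n k t 𝓕) (ht : 1 ≤ t) (hk : t + 2 ≤ k)
    (hn : (t + 3) * (k + 1 - t) < 2 * n)
    (hs : ∀ a b, 1 ≤ a → a < b → b ≤ n → shift a b 𝓕 = 𝓕) : IsStandard n k t 𝓕 := by
  have hsh : IsShifted n 𝓕 := by
    intro a b ha hab hb A hA hbA haA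
    rw [← exchange_eq_insert_erase hbA haA]
    exact exchange_mem_of_shift_eq (hs a b ha hab hb) hA hbA haA
  obtain ⟨T, Z, hT, hZ, hTZ, hTt, hZ2, hZk, rfl⟩ :=
    h.exists_eq_standardFamily_of_isShifted hsh ht hk hn
  exact ⟨T, Z, hT, hZ, hTZ, hTt, card_eq_of_isLargest_standardFamily hT hZ hTZ hTt ht hZ2 hZk hk
    (two_mul_add_two_le ht hk hn) h, rfl⟩

theorem IsLargest.isStandard_of_erase_mem (h : IsLargest n k t 𝓕) (ht : 1 ≤ t) (hk : t + 2 ≤ k)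
    (hn : (t + 3) * (k + 1 - t) < 2 * n)
    (ha : ∀ x ∈ Icc t (k + 1), (Icc 1 (k + 1)).erase x ∈ 𝓕) : IsStandard n k t 𝓕 := by
  induction hw : weight 𝓕 using Nat.strong_induction_on generalizing 𝓕 with
  | _ w ih =>
    by_cases hs : ∀ a b, 1 ≤ a → a < b → b ≤ n → shift a b 𝓕 = 𝓕
    · exact h.isStandard_of_shift_eq ht hk hn hs
    · push Not at hs
      obtain ⟨a, b, ha1, hab, hbn, hne⟩ := hs
      have haI : a ∈ Icc 1 n := mem_Icc.2 (by omega)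
      have hbI : b ∈ Icc 1 n := mem_Icc.2 (by omega)
      have hanch : ∀ x ∈ Icc t (k + 1), (Icc 1 (k + 1)).erase x ∈ shift a b 𝓕 := by
        intro x hx
        refine mem_shift.2 (Or.inl ⟨ha x hx, fun ⟨hb, hna⟩ => ?_⟩)
        have hb' := mem_Icc.1 (mem_of_mem_erase hb)
        have hax : a = x := by
          by_contra hax
          exact hna (mem_erase.2 ⟨hax, mem_Icc.2 (by omega)⟩)
        rw [exchange_eq_insert_erase hb hna, erase_right_comm, ← hax,
          insert_erase (mem_erase.2 ⟨hab.ne, mem_Icc.2 (by omega)⟩)]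
        rw [mem_Icc] at hx
        exact ha b (mem_Icc.2 (by omega))
      refine isStandard_of_shift ht hk (two_mul_add_two_le ht hk hn) haI hbI h.1.le_card_inter
        (ih _ (hw ▸ weight_shift_lt hab hne) (h.isLargest_shift haI hbI fun T hT => ?_) hanch rfl)
      have hT' : T ⊆ Icc 1 (t - 1) := by
        intro x hx
        have h1 := mem_Icc.1 (mem_of_mem_erase
          (hT _ (hanch t (mem_Icc.2 ⟨le_rfl, by omega⟩)) hx))
        by_contra hxt
        rw [mem_Icc] at hxt
        exact notMem_erase x _ (hT _ (hanch x (mem_Icc.2 (by omega))) hx)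
      have := card_le_card hT'
      rw [Nat.card_Icc] at this
      omega

theorem NontrivialIntersecting.exists_of_forall_shift (h : NontrivialIntersecting n k t 𝓕)
    {T : Finset ℕ} (hTt : t ≤ #T) (hT : ∀ A ∈ shift i j 𝓕, T ⊆ A) :
    ∃ T₀ ⊆ Icc 1 n, #T₀ + 1 = t ∧ Disjoint T₀ {i, j} ∧
      ∀ A ∈ 𝓕, T₀ ⊆ A ∧ (A ∩ {i, j}).Nonempty := by
  have key : ∀ A ∈ 𝓕, T ⊆ A ∨ (j ∈ A ∧ i ∉ A ∧ T ⊆ insert i (A.erase j)) := by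
    intro A hA
    by_cases hAs : A ∈ shift i j 𝓕
    · exact Or.inl (hT A hAs)
    · have h1 : j ∈ A ∧ i ∉ A ∧ exchange i j A ∉ 𝓕 := by
        rw [mem_shift] at hAs
        tauto
      refine Or.inr ⟨h1.1, h1.2.1, ?_⟩
      rw [← exchange_eq_insert_erase h1.1 h1.2.1]
      refine hT _ (mem_shift.2 (Or.inr ⟨by rwa [exchange_exchange], ?_⟩))
      rw [exchange_eq_insert_erase h1.1 h1.2.1]
      refine ⟨mem_insert_self _ _, ?_⟩
      rw [mem_insert, not_or]
      exact ⟨fun hji => h1.2.1 (hji ▸ h1.1), notMem_erase _ _⟩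
  obtain ⟨A, hA, hTA⟩ : ∃ A ∈ 𝓕, ¬ T ⊆ A := by
    by_contra hc
    push Not at hc
    exact (h.card_lt T hc).not_ge hTt
  obtain ⟨hjA, hiA, hTA'⟩ := (key A hA).resolve_left hTA
  have hij : j ≠ i := fun hji => hiA (hji ▸ hjA)
  have hjT : j ∉ T := fun hj => by simpa [hij] using hTA' hj
  have hiT : i ∈ T := by
    obtain ⟨x, hxT, hxA⟩ := not_subset.1 hTA
    rcases mem_insert.1 (hTA' hxT) with hx | hx
    exacts [hx ▸ hxT, absurd (mem_of_mem_erase hx) hxA]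
  have hall : ∀ B ∈ 𝓕, T.erase i ⊆ B ∧ (B ∩ {i, j}).Nonempty := by
    intro B hB
    rcases key B hB with h1 | ⟨h1, -, h2⟩
    · exact ⟨(erase_subset _ _).trans h1, i, by simp [h1 hiT]⟩
    · exact ⟨(subset_insert_iff.1 h2).trans (erase_subset _ _), j, by simp [h1]⟩
  refine ⟨T.erase i, (hall A hA).1.trans (h.subset A hA), ?_, ?_, hall⟩
  · have h1 := h.card_lt _ fun B hB => (hall B hB).1
    rw [card_erase_of_mem hiT] at h1 ⊢
    have := card_pos.2 ⟨i, hiT⟩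
    omega
  · simp [disjoint_right, hjT]

theorem IsLargest.mem_of_Icc_subset (h : IsLargest n k t 𝓕)
    (hP : ∀ A ∈ 𝓕, Icc 1 (t - 1) ⊆ A ∧ (t ∈ A ∨ t + 1 ∈ A)) (ht : 1 ≤ t) (hk : t ≤ k)
    {B : Finset ℕ} (hB : B ⊆ Icc 1 n) (hBk : #B = k) (htB : Icc 1 (t + 1) ⊆ B) : B ∈ 𝓕 := by
  have hBA : ∀ A ∈ 𝓕, t ≤ #(B ∩ A) := by
    intro A hA
    obtain ⟨h1, h2⟩ := hP A hA
    obtain ⟨y, hyA, hy⟩ : ∃ y ∈ A, y = t ∨ y = t + 1 :=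
      h2.elim (fun h => ⟨_, h, Or.inl rfl⟩) fun h => ⟨_, h, Or.inr rfl⟩
    have h3 : insert y (Icc 1 (t - 1)) ⊆ B ∩ A := by
      refine insert_subset (mem_inter.2 ⟨htB (mem_Icc.2 (by omega)), hyA⟩)
        (subset_inter ((Icc_subset_Icc_right (by omega)).trans htB) h1)
    have h4 := card_le_card h3
    rw [card_insert_of_notMem (by rw [mem_Icc]; omega), Nat.card_Icc] at h4
    omega
  have hins : NontrivialIntersecting n k t (insert B 𝓕) := by
    refine ⟨?_, ?_, ?_, fun T hT => h.1.card_lt T fun A hA => hT A (mem_insert_of_mem hA)⟩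
    · simpa [hB] using h.1.subset
    · simpa [hBk] using h.1.card_eq
    · intro A hA C hC
      rcases mem_insert.1 hA with hA' | hA' <;> rcases mem_insert.1 hC with hC' | hC'
      · rwa [hA', hC', inter_self, hBk]
      · rw [hA']
        exact hBA C hC'
      · rw [hC', inter_comm]
        exact hBA A hA'
      · exact h.1.le_card_inter A hA' C hC'
  have h1 := h.2 _ hins
  by_contra hBF
  rw [card_insert_of_notMem hBF] at h1
  omega

theorem union_Ico_mem_of_shift_eq (h : ∀ A ∈ 𝓕, A ⊆ Icc 1 n) {p : ℕ}
    (hs : ∀ a b, p + 1 ≤ a → a < b → b ≤ n → shift a b 𝓕 = 𝓕) {A : Finset ℕ} (hA : A ∈ 𝓕) :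
    A ∩ Icc 1 p ∪ Ico (p + 1) (p + 1 + #(A \ Icc 1 p)) ∈ 𝓕 := by
  refine (of_forall_insert_erase (lo := p + 1) (D := A \ Icc 1 p)
    (Q := fun D => D ⊆ Icc (p + 1) n ∧ A ∩ Icc 1 p ∪ D ∈ 𝓕) ?_ ⟨?_, ?_⟩ ?_).2
  · rintro D ⟨hD, hDF⟩ a b ha hab hb haD
    have hbI := mem_Icc.1 (hD hb)
    refine ⟨insert_subset (mem_Icc.2 (by omega)) ((erase_subset _ _).trans hD), ?_⟩
    have hnot : ∀ x, p + 1 ≤ x → x ∉ A ∩ Icc 1 p := by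
      intro x hx hxA
      rw [mem_inter, mem_Icc] at hxA
      omega
    have h1 := exchange_mem_of_shift_eq (hs a b ha hab hbI.2) hDF (mem_union_right _ hb)
      (by rw [mem_union, not_or]; exact ⟨hnot a ha, haD⟩)
    rw [exchange_eq_insert_erase (mem_union_right _ hb)
      (by rw [mem_union, not_or]; exact ⟨hnot a ha, haD⟩), erase_union_distrib,
      erase_eq_of_notMem (hnot b hbI.1), ← union_insert] at h1
    exact h1
  · intro x hx
    rw [mem_sdiff, mem_Icc] at hx
    have := mem_Icc.1 (h A hA hx.1)
    exact mem_Icc.2 (by omega)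
  · rwa [union_comm, sdiff_union_inter]
  · intro x hx
    rw [mem_sdiff, mem_Icc] at hx
    have := mem_Icc.1 (h A hA hx.1)
    omega

theorem IsLargest.isStandard_of_shift_eq_of_forall (h : IsLargest n k t 𝓕) (ht : 1 ≤ t)
    (hk : t + 2 ≤ k) (hn : (t + 3) * (k + 1 - t) < 2 * n)
    (hP : ∀ A ∈ 𝓕, Icc 1 (t - 1) ⊆ A ∧ (t ∈ A ∨ t + 1 ∈ A))
    (hs : ∀ a b, t + 2 ≤ a → a < b → b ≤ n → shift a b 𝓕 = 𝓕) : IsStandard n k t 𝓕 := by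
  have hg := two_mul_add_two_le ht hk hn
  have hmiss : ∀ x, x = t ∨ x = t + 1 → (Icc 1 (k + 1)).erase x ∈ 𝓕 := by
    intro x hx
    obtain ⟨A, hA, hxA⟩ : ∃ A ∈ 𝓕, x ∉ A := by
      by_contra hc
      push Not at hc
      have := h.1.card_lt (insert x (Icc 1 (t - 1))) fun A hA =>
        insert_subset (hc A hA) (hP A hA).1
      rw [card_insert_of_notMem (by rw [mem_Icc]; omega), Nat.card_Icc] at this
      omega
    obtain ⟨h1, h2⟩ := hP A hA
    have h3 : A ∩ Icc 1 (t + 1) = (Icc 1 (t + 1)).erase x := by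
      ext y
      have h4 : y ∈ Icc 1 (t - 1) → y ∈ A := fun hy => h1 hy
      rw [mem_Icc] at h4
      rw [mem_inter, mem_erase, mem_Icc]
      constructor
      · rintro ⟨h5, h6⟩
        exact ⟨fun h => hxA (h ▸ h5), h6⟩
      · rintro ⟨h5, h6⟩
        refine ⟨?_, h6⟩
        by_cases hy : y ≤ t - 1
        · exact h4 ⟨h6.1, hy⟩
        · have : (y = t ∧ x = t + 1) ∨ (y = t + 1 ∧ x = t) := by omega
          rcases this with ⟨rfl, rfl⟩ | ⟨rfl, rfl⟩ <;> tauto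
    have h4 := union_Ico_mem_of_shift_eq h.1.subset (p := t + 1) hs hA
    have h5 := card_sdiff_add_card_inter A (Icc 1 (t + 1))
    rw [h3, card_erase_of_mem (mem_Icc.2 (by omega)), Nat.card_Icc, h.1.card_eq A hA] at h5
    convert h4 using 1
    rw [h3, show t + 1 + 1 + #(A \ Icc 1 (t + 1)) = k + 2 by omega]
    ext y
    simp only [mem_erase, mem_union, mem_Icc, mem_Ico]
    omega
  refine h.isStandard_of_erase_mem ht hk hn fun x hx => ?_
  rw [mem_Icc] at hx
  by_cases hxt : x = t ∨ x = t + 1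
  · exact hmiss x hxt
  · refine h.mem_of_Icc_subset hP ht (by omega)
      ((erase_subset _ _).trans (Icc_subset_Icc_right (by omega))) ?_ ?_
    · rw [card_erase_of_mem (mem_Icc.2 (by omega)), Nat.card_Icc]
      omega
    · intro y hy
      rw [mem_Icc] at hy
      exact mem_erase.2 ⟨by omega, mem_Icc.2 (by omega)⟩

theorem exists_mem_shift_of_mem {A : Finset ℕ} (hA : A ∈ 𝓕) :
    A ∈ shift i j 𝓕 ∨ exchange i j A ∈ shift i j 𝓕 := by
  by_cases hAs : A ∈ shift i j 𝓕
  · exact Or.inl hAs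
  · have h1 : j ∈ A ∧ i ∉ A ∧ exchange i j A ∉ 𝓕 := by
      rw [mem_shift] at hAs
      tauto
    refine Or.inr (mem_shift.2 (Or.inr ⟨by rwa [exchange_exchange], ?_⟩))
    have hij : j ≠ i := fun hji => h1.2.1 (hji ▸ h1.1)
    rw [exchange_eq_insert_erase h1.1 h1.2.1]
    simp [hij]

theorem mem_exchange_of_ne {x : ℕ} {A : Finset ℕ} (hxi : x ≠ i) (hxj : x ≠ j) :
    x ∈ exchange i j A ↔ x ∈ A := by
  simp [mem_exchange, hxi, hxj]

theorem IsLargest.isStandard_of_forall (h : IsLargest n k t 𝓕) (ht : 1 ≤ t)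
    (hk : t + 2 ≤ k) (hn : (t + 3) * (k + 1 - t) < 2 * n)
    (hP : ∀ A ∈ 𝓕, Icc 1 (t - 1) ⊆ A ∧ (t ∈ A ∨ t + 1 ∈ A)) : IsStandard n k t 𝓕 := by
  induction hw : weight 𝓕 using Nat.strong_induction_on generalizing 𝓕 with
  | _ w ih =>
    by_cases hs : ∀ a b, t + 2 ≤ a → a < b → b ≤ n → shift a b 𝓕 = 𝓕
    · exact h.isStandard_of_shift_eq_of_forall ht hk hn hP hs
    · push Not at hs
      obtain ⟨a, b, ha, hab, hbn, hne⟩ := hs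
      have hg := two_mul_add_two_le ht hk hn
      have haI : a ∈ Icc 1 n := mem_Icc.2 (by omega)
      have hbI : b ∈ Icc 1 n := mem_Icc.2 (by omega)
      have hex : ∀ x < t + 2, ∀ A, x ∈ exchange a b A ↔ x ∈ A := fun x hx A =>
        mem_exchange_of_ne (by omega) (by omega)
      have hP' : ∀ A ∈ shift a b 𝓕, Icc 1 (t - 1) ⊆ A ∧ (t ∈ A ∨ t + 1 ∈ A) := by
        intro A hA
        rcases mem_shift.1 hA with h1 | h1
        · exact hP A h1.1
        · obtain ⟨h2, h3⟩ := hP _ h1.1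
          rw [hex t (by omega), hex (t + 1) (by omega)] at h3
          refine ⟨fun x hx => ?_, h3⟩
          have hx' := mem_Icc.1 hx
          exact (hex x (by omega) A).1 (h2 hx)
      refine isStandard_of_shift ht hk hg haI hbI h.1.le_card_inter
        (ih _ (hw ▸ weight_shift_lt hab hne) (h.isLargest_shift haI hbI fun T hT => ?_) hP' rfl)
      have hmiss : ∀ x, x = t ∨ x = t + 1 → x ∉ T := by
        intro x hx hxT
        have := h.1.card_lt (insert x (Icc 1 (t - 1))) fun A hA => by
          refine insert_subset ?_ (hP A hA).1
          rcases exists_mem_shift_of_mem (i := a) (j := b) hA with h1 | h1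
          · exact hT _ h1 hxT
          · exact (hex x (by omega) A).1 (hT _ h1 hxT)
        rw [card_insert_of_notMem (by rw [mem_Icc]; omega), Nat.card_Icc] at this
        omega
      have hT' : T ⊆ Icc 1 (t - 1) := by
        intro x hx
        by_contra hxt
        have hx1 := hmiss x
        have hxI : x ∉ Icc 1 (t + 1) := by
          rw [mem_Icc] at hxt ⊢
          intro hc
          exact hx1 (by omega) hx
        have hsub : Icc 1 (t + 1) ⊆ (Icc 1 n).erase x :=
          subset_erase.2 ⟨Icc_subset_Icc_right (by omega), hxI⟩
        have hc1 := pred_card_le_card_erase (a := x) (s := Icc 1 n)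
        rw [Nat.card_Icc] at hc1
        obtain ⟨B, hB1, hB2, hBk⟩ := exists_subsuperset_card_eq (n := k) hsub
          (by rw [Nat.card_Icc]; omega) (by omega)
        obtain ⟨hB3, hxB⟩ := subset_erase.1 hB2
        have hBex : Icc 1 (t + 1) ⊆ exchange a b B := by
          intro y hy
          have hy' := mem_Icc.1 hy
          exact (hex y (by omega) B).2 (hB1 hy)
        have hBs : B ∈ shift a b 𝓕 := mem_shift.2 (Or.inl
          ⟨h.mem_of_Icc_subset hP ht (by omega) hB3 hBk hB1, fun _ =>
            h.mem_of_Icc_subset hP ht (by omega) (exchange_subset haI hbI hB3)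
              (by rwa [card_exchange]) hBex⟩)
        exact hxB (hT B hBs hx)
      have := card_le_card hT'
      rw [Nat.card_Icc] at this
      omega

/-- The structure of the largest nontrivial `t`-intersecting families. -/
theorem IsLargest.isStandard (h : IsLargest n k t 𝓕) (ht : 1 ≤ t) (hk : t + 2 ≤ k)
    (hn : (t + 3) * (k + 1 - t) < 2 * n) : IsStandard n k t 𝓕 := by
  induction hw : weight 𝓕 using Nat.strong_induction_on generalizing 𝓕 with
  | _ w ih =>
    by_cases hs : ∀ a b, 1 ≤ a → a < b → b ≤ n → shift a b 𝓕 = 𝓕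
    · exact h.isStandard_of_shift_eq ht hk hn hs
    · push Not at hs
      obtain ⟨a, b, ha, hab, hbn, hne⟩ := hs
      have haI : a ∈ Icc 1 n := mem_Icc.2 (by omega)
      have hbI : b ∈ Icc 1 n := mem_Icc.2 (by omega)
      by_cases hnt : ∀ T : Finset ℕ, (∀ A ∈ shift a b 𝓕, T ⊆ A) → #T < t
      · exact isStandard_of_shift ht hk (two_mul_add_two_le ht hk hn) haI hbI h.1.le_card_inter
          (ih _ (hw ▸ weight_shift_lt hab hne) (h.isLargest_shift haI hbI hnt) rfl)
      · push Not at hnt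
        obtain ⟨T, hT, hTt⟩ := hnt
        obtain ⟨T₀, hT₀, hc, hdisj, hall⟩ := h.1.exists_of_forall_shift hTt hT
        obtain ⟨σ, hσ, h1, h2⟩ := exists_perm_image_eq_Icc (p := t - 1) hT₀
          (insert_subset haI (singleton_subset_iff.2 hbI)) hdisj (by omega) (card_pair hab.ne)
        refine isStandard_of_permute hσ ((h.permute hσ).isStandard_of_forall ht hk hn ?_)
        simp only [_root_.permute, forall_mem_image]
        intro A hA
        obtain ⟨h3, h4⟩ := hall A hA
        refine ⟨h1 ▸ image_subset_image h3, ?_⟩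
        obtain ⟨y, hy⟩ := h4.image σ
        rw [image_inter _ _ σ.injective, h2, mem_inter, mem_Icc] at hy
        have : y = t ∨ y = t + 1 := by omega
        rcases this with rfl | rfl
        exacts [Or.inl hy.1, Or.inr hy.1]

end

section

variable {n k t : ℕ} {𝓕 : Finset (Finset ℕ)}

theorem famA_eq_standardFamily (n k t : ℕ) :
    famA n k (t + 1) = standardFamily n k (Icc 1 t) (Icc (t + 1) (t + 2)) := by
  ext A
  rw [famA, mem_filter, mem_powersetCard]
  constructor
  · rintro ⟨⟨hA, hAk⟩, h⟩
    exact mem_standardFamily_Icc hA hAk h fun y hy => le_card_inter_insert h hy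
  · intro h
    obtain ⟨hA, h⟩ := mem_standardFamily.1 h
    refine ⟨hA, ?_⟩
    have h1 : #(A ∩ Icc 1 t) + #(A ∩ Icc (t + 1) (t + 2)) ≤ #(A ∩ Icc 1 (t + 1 + 1)) := by
      rw [← card_union_of_disjoint ((disjoint_Icc_Icc_succ t (t + 2)).mono inter_subset_right
        inter_subset_right), ← inter_union_distrib_left]
      refine card_le_card (inter_subset_inter_left (union_subset ?_ ?_))
      · exact Icc_subset_Icc_right (by omega)
      · exact Icc_subset_Icc_left (by omega)
    rcases h with ⟨h2, h3⟩ | ⟨h2, h3⟩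
    · rw [inter_eq_right.2 h2, Nat.card_Icc] at h1
      have := card_pos.2 h3
      omega
    · rw [inter_eq_right.2 h2, Nat.card_Icc] at h1
      rw [Nat.card_Icc] at h3
      omega

theorem famH_eq_standardFamily (htk : t ≤ k) (hkn : k + 1 ≤ n) :
    famH n k (t + 1) = standardFamily n k (Icc 1 t) (Icc (t + 1) (k + 1)) := by
  ext A
  rw [famH, mem_union, mem_filter, mem_powersetCard, mem_image, Nat.add_sub_cancel,
    mem_standardFamily]
  simp only [sdiff_singleton_eq_erase]
  constructor
  · rintro (⟨h1, h2⟩ | ⟨x, hx, rfl⟩)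
    · exact ⟨h1, Or.inl h2⟩
    · have hx' := mem_Icc.1 hx
      refine ⟨⟨(erase_subset _ _).trans (Icc_subset_Icc_right hkn), ?_⟩, Or.inr ⟨?_, ?_⟩⟩
      · rw [card_erase_of_mem (mem_Icc.2 (by omega)), Nat.card_Icc]
        omega
      · refine subset_erase.2 ⟨Icc_subset_Icc_left (by omega), ?_⟩
        rw [mem_Icc]
        omega
      · rw [erase_inter, inter_eq_right.2 (Icc_subset_Icc_right (by omega)),
          card_erase_of_mem hx]
        omega
  · rintro ⟨⟨hA, hAk⟩, h⟩
    by_cases hT : Icc 1 t ⊆ A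
    · refine Or.inl ⟨⟨hA, hAk⟩, hT, ?_⟩
      rcases h with h | h
      · exact h.2
      · rw [inter_eq_right.2 h.1]
        exact nonempty_Icc.2 (by omega)
    · obtain ⟨h2, h3⟩ := h.resolve_left fun h => hT h.1
      obtain ⟨x, hx, hxA⟩ := not_subset.1 hT
      refine Or.inr ⟨x, hx, ?_⟩
      have h4 : A ∩ Icc 1 t ∪ Icc (t + 1) (k + 1) ⊆ A := union_subset inter_subset_left h2
      have h5 : A ∩ Icc 1 t ∪ Icc (t + 1) (k + 1) = A := by
        refine eq_of_subset_of_card_le h4 ?_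
        rw [card_union_of_disjoint
          ((disjoint_Icc_Icc_succ t (k + 1)).mono_left inter_subset_right), hAk]
        rw [Nat.card_Icc] at h3 ⊢
        omega
      have h6 : A ⊆ (Icc 1 (k + 1)).erase x := by
        rw [subset_erase]
        refine ⟨?_, hxA⟩
        rw [← h5]
        exact union_subset (inter_subset_right.trans (Icc_subset_Icc_right (by omega)))
          (Icc_subset_Icc_left (by omega))
      rw [mem_Icc] at hx
      refine (eq_of_subset_of_card_le h6 ?_).symm
      rw [card_erase_of_mem (mem_Icc.2 (by omega)), Nat.card_Icc, hAk]
      omega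

theorem IsStandard.exists_eq_permute (h : IsStandard n k t 𝓕) (htk : t ≤ k)
    (hkn : k + 1 ≤ n) :
    ∃ σ : Equiv.Perm ℕ, (∀ x, x ∉ Icc 1 n → σ x = x) ∧
      (𝓕 = permute σ (famA n k (t + 1)) ∨ 𝓕 = permute σ (famH n k (t + 1))) := by
  obtain ⟨T, Z, hT, hZ, hTZ, hTt, hZc, rfl⟩ := h
  obtain ⟨σ, hσ, h1, h2⟩ := exists_perm_image_eq_Icc hT hZ hTZ hTt rfl
  have h3 : standardFamily n k T Z =
      permute σ.symm (standardFamily n k (Icc 1 t) (Icc (t + 1) (t + #Z))) := by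
    rw [← h1, ← h2, ← permute_standardFamily hσ, permute_permute,
      show σ.symm * σ = 1 from inv_mul_cancel σ, permute_one]
  refine ⟨σ.symm, perm_symm_fix hσ, ?_⟩
  rcases hZc with hZc | hZc
  · rw [hZc, ← famA_eq_standardFamily] at h3
    exact Or.inl h3
  · rw [hZc, ← famH_eq_standardFamily htk hkn] at h3
    exact Or.inr h3

theorem NontrivialIntersecting.exists_isLargest (h : NontrivialIntersecting n k t 𝓕) :
    ∃ 𝓖, IsLargest n k t 𝓖 := by
  classical
  have hmem : ∀ {𝓖 : Finset (Finset ℕ)}, NontrivialIntersecting n k t 𝓖 →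
      𝓖 ∈ ((Icc 1 n).powersetCard k).powerset.filter (NontrivialIntersecting n k t) := by
    intro 𝓖 h𝓖
    rw [mem_filter, mem_powerset]
    exact ⟨fun A hA => mem_powersetCard.2 ⟨h𝓖.subset A hA, h𝓖.card_eq A hA⟩, h𝓖⟩
  obtain ⟨𝓖, h𝓖, hmax⟩ := exists_max_image _ card ⟨𝓕, hmem h⟩
  exact ⟨𝓖, (mem_filter.1 h𝓖).2, fun 𝓗 h𝓗 => hmax 𝓗 (hmem h𝓗)⟩

theorem exists_forall_mem_of_card_le {d : ℕ} {𝒮 : Finset (Finset ℕ)}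
    (hint : ∀ G : Fin d → Finset ℕ, (∀ i, G i ∈ 𝓕) → (⋂ i, (G i : Set ℕ)).Nonempty)
    (hS : 𝒮 ⊆ 𝓕) (hne : 𝒮.Nonempty) (hd : #𝒮 ≤ d) : ∃ x, ∀ A ∈ 𝒮, x ∈ A := by
  obtain ⟨A₀, hA₀⟩ := hne
  obtain ⟨x, hx⟩ := hint
    (fun i => if h : (i : ℕ) < #𝒮 then 𝒮.equivFin.symm ⟨i, h⟩ else A₀) (fun i => by
      split_ifs
      exacts [hS (coe_mem _), hS hA₀])
  refine ⟨x, fun A hA => ?_⟩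
  have hlt := (𝒮.equivFin ⟨A, hA⟩).2
  have := Set.mem_iInter.1 hx ⟨𝒮.equivFin ⟨A, hA⟩, by omega⟩
  simpa using this

/-- A `(t+1)`-wise intersecting family without a common element is `t`-intersecting. -/
theorem le_card_inter_of_forall_iInter_nonempty
    (hint : ∀ G : Fin (t + 1) → Finset ℕ, (∀ i, G i ∈ 𝓕) → (⋂ i, (G i : Set ℕ)).Nonempty)
    (h𝓕 : ∀ x, ∃ A ∈ 𝓕, x ∉ A) {A B : Finset ℕ} (hA : A ∈ 𝓕) (hB : B ∈ 𝓕) :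
    t ≤ #(A ∩ B) := by
  by_contra hc
  choose f hf𝓕 hf using h𝓕
  have hsub : insert A (insert B ((A ∩ B).image f)) ⊆ 𝓕 :=
    insert_subset hA (insert_subset hB (image_subset_iff.2 fun y _ => hf𝓕 y))
  have hcard : #(insert A (insert B ((A ∩ B).image f))) ≤ t + 1 := by
    have h1 := card_insert_le A (insert B ((A ∩ B).image f))
    have h2 := card_insert_le B ((A ∩ B).image f)
    have h3 := card_image_le (s := A ∩ B) (f := f)
    omega
  obtain ⟨x, hx⟩ := exists_forall_mem_of_card_le hint hsub (insert_nonempty _ _) hcard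
  simp only [forall_mem_insert, forall_mem_image] at hx
  exact hf x (hx.2.2 (mem_inter.2 ⟨hx.1, hx.2.1⟩))

end

end

/-- If `𝓕` is a nonempty nontrivial `d`-wise intersecting family of `k`-subsets of `[n]`,
with `2 ≤ d < k`, `n ≥ k+1` and `2n > (d+2)(k-d+2)`, then
`|𝓕| ≤ max {|H(n,k,d)|, |A(n,k,d)|}`, with equality only if `𝓕` is the image of
`A(n,k,d)` or `H(n,k,d)` under a permutation of `[n]`. -/
theorem stmt_0 (n k d : ℕ) (hd : 2 ≤ d) (hdk : d < k) (hnk : k + 1 ≤ n)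
    (hn : ((d : ℤ) + 2) * ((k : ℤ) - d + 2) < 2 * n)
    (𝓕 : Finset (Finset ℕ)) (hne : 𝓕.Nonempty)
    (hunif : ∀ F ∈ 𝓕, F ⊆ Finset.Icc 1 n ∧ F.card = k)
    (hint : ∀ G : Fin d → Finset ℕ, (∀ i, G i ∈ 𝓕) → (⋂ i, (G i : Set ℕ)).Nonempty)
    (hnontriv : (⋂ F ∈ (𝓕 : Set (Finset ℕ)), (F : Set ℕ)) = ∅) :
    𝓕.card ≤ max (famH n k d).card (famA n k d).card ∧
      (𝓕.card = max (famH n k d).card (famA n k d).card →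
        ∃ σ : Equiv.Perm ℕ, (∀ x ∈ Finset.Icc 1 n, σ x ∈ Finset.Icc 1 n) ∧
          (𝓕 = (famA n k d).image (fun F => F.image σ) ∨
            𝓕 = (famH n k d).image (fun F => F.image σ))) := by
  obtain ⟨t, rfl⟩ : ∃ t, d = t + 1 := ⟨d - 1, by omega⟩
  have ht : 1 ≤ t := by omega
  have hn' : (t + 3) * (k + 1 - t) < 2 * n := by
    zify [show t ≤ k + 1 by omega]
    push_cast at hn
    linarith
  have hcommon : ∀ x, ∃ A ∈ 𝓕, x ∉ A := by
    intro x
    by_contra hc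
    push Not at hc
    have : x ∈ ⋂ F ∈ (𝓕 : Set (Finset ℕ)), (F : Set ℕ) := Set.mem_iInter₂.2 hc
    rw [hnontriv] at this
    exact this
  have h𝓕 : NontrivialIntersecting n k t 𝓕 := by
    refine ⟨fun A hA => (hunif A hA).1, fun A hA => (hunif A hA).2, fun A hA B hB =>
      le_card_inter_of_forall_iInter_nonempty hint hcommon hA hB, fun T hT => ?_⟩
    rw [Finset.card_eq_zero.2 (Finset.eq_empty_of_forall_notMem fun x hx => ?_)]
    · exact ht
    · obtain ⟨A, hA, hxA⟩ := hcommon x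
      exact hxA (hT A hA hx)
  have hlargest : ∀ 𝓖, IsLargest n k t 𝓖 → ∃ σ : Equiv.Perm ℕ,
      (∀ x, x ∉ Finset.Icc 1 n → σ x = x) ∧
      (𝓖 = permute σ (famA n k (t + 1)) ∨ 𝓖 = permute σ (famH n k (t + 1))) := fun 𝓖 h =>
    (h.isStandard ht (by omega) hn').exists_eq_permute (by omega) hnk
  obtain ⟨𝓖, h𝓖⟩ := h𝓕.exists_isLargest
  have h𝓖card : 𝓖.card ≤ max (famH n k (t + 1)).card (famA n k (t + 1)).card := by
    obtain ⟨σ, -, rfl | rfl⟩ := hlargest 𝓖 h𝓖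
    · rw [card_permute]
      exact le_max_right _ _
    · rw [card_permute]
      exact le_max_left _ _
  refine ⟨(h𝓖.2 𝓕 h𝓕).trans h𝓖card, fun heq => ?_⟩
  obtain ⟨σ, hσ, h⟩ := hlargest 𝓕 ⟨h𝓕, fun 𝓗 h𝓗 =>
    (h𝓖.2 𝓗 h𝓗).trans (h𝓖card.trans heq.ge)⟩
  exact ⟨σ, fun x hx => perm_mem hσ hx, h⟩
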